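/- arXiv:2506.21268 — 2 statements merged into one kernel-verified Lean document; each statement's English description precedes it below -/
import Mathlib

section
/- Every rational function f on a metric graph Γ is, up to an additive constant, a sum f = f_1 + ⋯ + f_n of chip firing moves which can be chosen with ‖f_i‖_∞ ≤ ‖f‖_∞ for all i; moreover, if f ∈ R(D) for an effective divisor D, then f_k ∈ R(D + div(f_1 + ⋯ + f_{k−1})) for all k, i.e. f_1, …, f_n is a sequence of legal chip firing moves. -/
open scoped ENNReal
open Set Function

namespace TropGraph

variable {G : Type*} [MetricSpace G]

/-! ### Metric graphs: length spaces with star-shaped neighbourhoods -/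

/-- The length of a path, via the extended variation of its extension to `ℝ`. -/
noncomputable def pathLength {x y : G} (g : Path x y) : ℝ≥0∞ :=
  eVariationOn (fun t : ℝ => g.extend t) (Set.Icc 0 1)

/-- The star with `v` branches of radius `ε`: a disjoint union of `v` copies of `[0, ε)`
with all the zeroes identified. -/
def starSetoid (v : ℕ) (ε : ℝ) : Setoid (Fin v × Set.Ico (0:ℝ) ε) where
  r a b := a = b ∨ ((a.2 : ℝ) = 0 ∧ (b.2 : ℝ) = 0)
  iseqv :=
    { refl := fun _ => Or.inl rfl
      symm := fun h => h.imp Eq.symm And.symm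
      trans := fun h₁ h₂ => by
        rcases h₁ with rfl | h₁
        · exact h₂
        · rcases h₂ with rfl | h₂
          · exact Or.inr h₁
          · exact Or.inr ⟨h₁.1, h₂.2⟩ }

/-- The glued star-shaped space `⊔_{i=1}^v [0, ε) / ∼`. -/
def StarGlue (v : ℕ) (ε : ℝ) : Type :=
  Quotient (starSetoid v ε)

instance (v : ℕ) (ε : ℝ) : TopologicalSpace (StarGlue v ε) := by
  unfold StarGlue; infer_instance

/-- `U` is a star-shaped neighbourhood of `x` of valence `v`. -/
def IsStarNbhdOf (x : G) (v : ℕ) (U : Set G) : Prop :=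
  ∃ (ε : ℝ) (hε : 0 < ε) (φ : U ≃ₜ StarGlue v ε) (hx : x ∈ U),
    ∀ i : Fin v, φ ⟨x, hx⟩ = Quotient.mk (starSetoid v ε) (i, ⟨0, le_rfl, hε⟩)

/-- A metric graph: a compact length space in which every point has a star-shaped
neighbourhood. -/
def IsMetricGraph (X : Type*) [MetricSpace X] : Prop :=
  CompactSpace X ∧
  (∀ x y : X, edist x y = ⨅ g : Path x y, pathLength g) ∧
  ∀ x : X, ∃ (v : ℕ) (U : Set X), U ∈ nhds x ∧ IsStarNbhdOf x v U

/-- `x` has valence `v`. -/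
def HasValence (x : G) (v : ℕ) : Prop :=
  ∃ U ∈ nhds x, IsStarNbhdOf x v U

/-! ### Rational functions, tangent directions, orders and divisors -/

/-- `g` is a unit speed (isometric) path of length `ε` starting at `x`. -/
def IsUnitSpeedFrom (x : G) (ε : ℝ) (g : ℝ → G) : Prop :=
  g 0 = x ∧ ∀ s ∈ Set.Ico (0:ℝ) ε, ∀ t ∈ Set.Ico (0:ℝ) ε, dist (g s) (g t) = |s - t|

/-- `f` has (integer) slope `s` along the path `g` near its starting point. -/
def HasSlopeAlong (f : G → ℝ) (g : ℝ → G) (s : ℤ) : Prop :=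
  ∃ δ > (0:ℝ), ∀ t ∈ Set.Ico (0:ℝ) δ, f (g t) = f (g 0) + s * t

/-- A rational function: continuous, and linear with integer slope along every direction
near every point.  (On a compact metric graph this coincides with being continuous
piecewise linear with integer slopes.) -/
def IsRational (f : G → ℝ) : Prop :=
  Continuous f ∧ ∀ (x : G) (ε : ℝ) (g : ℝ → G), 0 < ε → IsUnitSpeedFrom x ε g →
    ∃ s : ℤ, HasSlopeAlong f g s

/-- Unit speed paths emanating from `x`. -/
def UnitPath (x : G) : Type _ :=
  {g : ℝ → G // ∃ ε > (0:ℝ), IsUnitSpeedFrom x ε g}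

/-- Two unit speed paths are equivalent when they agree near `0`. -/
def germSetoid (x : G) : Setoid (UnitPath x) where
  r g₁ g₂ := ∃ δ > (0:ℝ), ∀ t ∈ Set.Ico (0:ℝ) δ, g₁.1 t = g₂.1 t
  iseqv := by
    constructor
    · intro g
      obtain ⟨ε, hε, _⟩ := g.2
      exact ⟨ε, hε, fun t _ => rfl⟩
    · rintro g₁ g₂ ⟨δ, hδ, h⟩
      exact ⟨δ, hδ, fun t ht => (h t ht).symm⟩
    · rintro g₁ g₂ g₃ ⟨δ₁, hδ₁, h₁⟩ ⟨δ₂, hδ₂, h₂⟩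
      refine ⟨min δ₁ δ₂, lt_min hδ₁ hδ₂, fun t ht => ?_⟩
      have ht' := Set.mem_Ico.mp ht
      rw [h₁ t (Set.mem_Ico.mpr ⟨ht'.1, lt_of_lt_of_le ht'.2 (min_le_left _ _)⟩),
        h₂ t (Set.mem_Ico.mpr ⟨ht'.1, lt_of_lt_of_le ht'.2 (min_le_right _ _)⟩)]

/-- The set of (unit) tangent directions at `x`: germs of unit speed paths from `x`. -/
def TangentDir (x : G) : Type _ :=
  Quotient (germSetoid x)

open scoped Classical in
/-- The outgoing slope of `f` along a tangent direction. -/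
noncomputable def tangentSlope (f : G → ℝ) {x : G} (ζ : TangentDir x) : ℤ :=
  if h : ∃ s : ℤ, HasSlopeAlong f (Quotient.out ζ).1 s then h.choose else 0

/-- The order of `f` at `x`: the sum of the outgoing slopes of `f` at `x`. -/
noncomputable def ordAt (f : G → ℝ) (x : G) : ℤ :=
  ∑ᶠ ζ : TangentDir x, tangentSlope f ζ

/-- Divisors are represented as finitely supported functions `G → ℤ`. -/
def FinSupp (D : G → ℤ) : Prop :=
  (Function.support D).Finite

/-- A divisor is effective when all its coefficients are nonnegative. -/
def Effective (D : G → ℤ) : Prop :=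
  ∀ x, 0 ≤ D x

/-- The degree of a divisor. -/
noncomputable def deg (D : G → ℤ) : ℤ :=
  ∑ᶠ x, D x

/-- The degree of the restriction of a divisor to a subset. -/
noncomputable def degOn (S : Set G) (D : G → ℤ) : ℤ :=
  ∑ᶠ x ∈ S, D x

/-- Linear equivalence of divisors: the difference is the divisor of a rational function. -/
def LinEquiv (D D' : G → ℤ) : Prop :=
  ∃ f : G → ℝ, IsRational f ∧ ∀ x, D' x = D x + ordAt f x

/-- `R(D)`: rational functions `f` with `D + div f ≥ 0`. -/
def RD (D : G → ℤ) : Set (G → ℝ) :=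
  {f | IsRational f ∧ ∀ x, 0 ≤ D x + ordAt f x}

/-- The complete linear system `|D₀|` of effective divisors linearly equivalent to `D₀`. -/
def LinSys (D₀ : G → ℤ) : Set (G → ℤ) :=
  {D | FinSupp D ∧ Effective D ∧ LinEquiv D₀ D}

/-- The oscillation `max f - min f` of a function. -/
noncomputable def osc (f : G → ℝ) : ℝ :=
  sSup (Set.range f) - sInf (Set.range f)

/-- The distance `d_∞` on a complete linear system. -/
noncomputable def linDist (D₁ D₂ : G → ℤ) : ℝ :=
  sInf {r : ℝ | ∃ f : G → ℝ, IsRational f ∧ (∀ x, D₂ x = D₁ x + ordAt f x) ∧ r = osc f}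

/-- `f` is constant on `S`. -/
def ConstOn (f : G → ℝ) (S : Set G) : Prop :=
  ∀ x ∈ S, ∀ y ∈ S, f x = f y

/-! ### Subgraphs, arcs, components, firing -/

/-- An open arc: the isometric image of a nonempty open interval. -/
def IsOpenArc (S : Set G) : Prop :=
  ∃ (a b : ℝ) (g : ℝ → G), a < b ∧
    (∀ s ∈ Set.Ioo a b, ∀ t ∈ Set.Ioo a b, dist (g s) (g t) = |s - t|) ∧
    S = g '' Set.Ioo a b

/-- The set of connected components of a subset. -/
def compsOf (S : Set G) : Set (Set G) :=
  {C | ∃ x ∈ S, C = connectedComponentIn S x}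

/-- The outgoing degree of `x` with respect to a closed subgraph `Z`:
the number of tangent directions at `x` leaving `Z`. -/
noncomputable def degOut (Z : Set G) (x : G) : ℕ :=
  Nat.card {ζ : TangentDir x //
    ∃ δ > (0:ℝ), ∀ t ∈ Set.Ioo (0:ℝ) δ, (Quotient.out ζ).1 t ∉ interior Z}

/-- A closed subgraph `Z` can fire with respect to `D` when `D(x) ≥ deg^out_Z(x)` for
all `x` on the boundary of `Z`. -/
def CanFire (D : G → ℤ) (Z : Set G) : Prop :=
  Z.Nonempty ∧ IsClosed Z ∧ (compsOf Z).Finite ∧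
  ∀ x ∈ frontier Z, (degOut Z x : ℤ) ≤ D x

/-- A `v`-reduced divisor. -/
def IsReduced (v : G) (D : G → ℤ) : Prop :=
  (∀ x, x ≠ v → 0 ≤ D x) ∧ ∀ Z : Set G, v ∉ Z → ¬CanFire D Z

/-- `D` is `V`-unsaturated: no closed subgraph whose boundary meets `V` can fire. -/
def Unsaturated (V : Set G) (D : G → ℤ) : Prop :=
  ¬∃ Z : Set G, (frontier Z ∩ V).Nonempty ∧ CanFire D Z

/-- A local maximum of `f`: a closed connected set on which `f` is constant, with a
neighbourhood on which `f` is strictly smaller outside of it. -/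
def IsLocalMaxSet (f : G → ℝ) (C : Set G) : Prop :=
  IsClosed C ∧ IsConnected C ∧ ConstOn f C ∧
  ∃ U, IsOpen U ∧ C ⊆ U ∧ ∀ x ∈ U \ C, ∀ y ∈ C, f x < f y

/-! ### Models and genus -/

/-- A model of the metric graph: a finite set of vertices whose complement is a finite
disjoint union of open arcs. -/
def IsGraphModel (V : Set G) : Prop :=
  V.Finite ∧ (compsOf Vᶜ).Finite ∧ ∀ C ∈ compsOf Vᶜ, IsOpenArc C

/-- A model has no self-loops: the closure of each open edge contains two distinct
endpoints. -/
def LoopFree (V : Set G) : Prop :=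
  ∀ C ∈ compsOf Vᶜ, (closure C \ C).ncard = 2

/-- A model of an open subgraph `U`, together with valences of its vertices inside `U`. -/
def IsModelIn (U V : Set G) (val : G → ℕ) : Prop :=
  V ⊆ U ∧ V.Finite ∧
  (∀ x ∈ V, ∃ W ∈ nhds x, W ⊆ U ∧ IsStarNbhdOf x (val x) W) ∧
  (compsOf (U \ V)).Finite ∧ (∀ C ∈ compsOf (U \ V), IsOpenArc C) ∧
  (compsOf U).Finite

/-- The genus (first Betti number) of an open subgraph `U`, i.e. of its completion:
computed from any model as `Σ val(x) - #edges - #vertices + #components`. -/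
def HasGenusOpen (U : Set G) (g : ℤ) : Prop :=
  ∃ (V : Set G) (val : G → ℕ), IsModelIn U V val ∧
    g = (∑ᶠ x ∈ V, (val x : ℤ)) - ((compsOf (U \ V)).ncard : ℤ)
        - (V.ncard : ℤ) + ((compsOf U).ncard : ℤ)

/-! ### Chip firing moves -/

/-- The open `ε`-neighbourhood of `Z`. -/
def ZNbhd (Z : Set G) (ε : ℝ) : Set G :=
  {x | Metric.infDist x Z < ε}

/-- The chip firing function `CF(Z, ε)`. -/
noncomputable def CF (Z : Set G) (ε : ℝ) : G → ℝ :=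
  fun x => -min (Metric.infDist x Z) ε

/-- The data of a chip firing move: a closed subgraph with finitely many components such
that `Z_ε \ Z` is a disjoint union of open intervals. -/
def ChipData (Z : Set G) (ε : ℝ) : Prop :=
  IsClosed Z ∧ Z.Nonempty ∧ (compsOf Z).Finite ∧
  ∀ C ∈ compsOf (ZNbhd Z ε \ Z), IsOpenArc C

/-- `h` is a chip firing move. -/
def IsCFMove (h : G → ℝ) : Prop :=
  ∃ (Z : Set G) (ε : ℝ), 0 < ε ∧ ChipData Z ε ∧ h = CF Z ε

/-- `f` is linear (with some real slope) on the open arc `C`. -/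
def LinearOnArc (f : G → ℝ) (C : Set G) : Prop :=
  ∃ (a b : ℝ) (g : ℝ → G) (s c : ℝ), a < b ∧
    (∀ u ∈ Set.Ioo a b, ∀ t ∈ Set.Ioo a b, dist (g u) (g t) = |u - t|) ∧
    C = g '' Set.Ioo a b ∧ ∀ t ∈ Set.Ioo a b, f (g t) = s * t + c

/-- A weighted chip firing move. -/
def IsWeightedCF (f : G → ℝ) : Prop :=
  IsRational f ∧ (¬∀ x y : G, f x = f y) ∧
  ∃ Z₁ Z₂ : Set G, IsClosed Z₁ ∧ IsClosed Z₂ ∧ Z₁.Nonempty ∧ Z₂.Nonempty ∧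
    Disjoint Z₁ Z₂ ∧ Z₁ ≠ Set.univ ∧ Z₂ ≠ Set.univ ∧
    (∀ C ∈ compsOf (Z₁ ∪ Z₂)ᶜ, IsOpenArc C) ∧
    ConstOn f Z₁ ∧ ConstOn f Z₂ ∧
    ∀ C ∈ compsOf (Z₁ ∪ Z₂)ᶜ, LinearOnArc f C

/-! ### Cells of the complete linear system -/

/-- The part of the support of a divisor lying in the interiors of the edges. -/
def edgeSupp (V : Set G) (D : G → ℤ) : Set G :=
  {x | x ∉ V ∧ D x ≠ 0}

/-- The dimension of the cell of `|D₀|` containing `D` in its relative interior: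
the number of connected components of `Γ ∖ supp D_E`, minus one. -/
noncomputable def cellDim (V : Set G) (D : G → ℤ) : ℤ :=
  ((compsOf (edgeSupp V D)ᶜ).ncard : ℤ) - 1

/-- Two divisors of `|D₀|` have the same combinatorial type with respect to the model `V`
(they lie in the relative interior of the same cell): equal multiplicities on the
vertices, chip configurations on the edges related by a homeomorphism fixing the
vertices and each edge, and equal slopes at all tangent directions at the vertices. -/
def SameType (V : Set G) (D₀ D₁ D₂ : G → ℤ) : Prop :=
  (∀ v ∈ V, D₁ v = D₂ v) ∧
  (∃ h : G ≃ₜ G, (∀ v ∈ V, h v = v) ∧ (∀ x ∉ V, h x ∈ connectedComponentIn Vᶜ x) ∧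
    ∀ x, D₂ (h x) = D₁ x) ∧
  (∃ f₁ f₂ : G → ℝ, IsRational f₁ ∧ IsRational f₂ ∧
    (∀ x, D₁ x = D₀ x + ordAt f₁ x) ∧ (∀ x, D₂ x = D₀ x + ordAt f₂ x) ∧
    ∀ v ∈ V, ∀ ζ : TangentDir v, tangentSlope f₁ ζ = tangentSlope f₂ ζ)

/-- `D'` lies in the closed cell `Δ_D` of `|D₀|`. -/
def InClosedCell (V : Set G) (D₀ D D' : G → ℤ) : Prop :=
  ∀ ε > (0:ℝ), ∃ D'' : G → ℤ, SameType V D₀ D D'' ∧ linDist D' D'' < ε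

/-- `D` is generic in `|D₀|`: it lies in the relative interior of an inclusion-wise
maximal cell, i.e. all sufficiently nearby divisors of `|D₀|` lie in the closed cell
of `D`. -/
def Generic (V : Set G) (D₀ D : G → ℤ) : Prop :=
  D ∈ LinSys D₀ ∧ ∃ ε > (0:ℝ), ∀ D' ∈ LinSys D₀, linDist D D' < ε → InClosedCell V D₀ D D'

/-- The rank of `D` is at least `d`: for every effective divisor `E` of degree `d`,
`|D - E|` is nonempty. -/
def rankGe (D : G → ℤ) (d : ℕ) : Prop :=
  ∀ E : G → ℤ, FinSupp E → Effective E → deg E = (d : ℤ) →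
    ∃ D' : G → ℤ, FinSupp D' ∧ Effective D' ∧ LinEquiv (fun x => D x - E x) D'

/-! ### Cycles, the canonical divisor and realizability -/

/-- A simple cycle: a subset homeomorphic to a circle. -/
def IsCycleSet (C : Set G) : Prop :=
  Nonempty (C ≃ₜ AddCircle (1 : ℝ))

/-- The canonical divisor `K + div f` for a vertex valence function `val`. -/
noncomputable def canDiv (val : G → ℕ) (f : G → ℝ) : G → ℤ :=
  fun x => (val x : ℤ) - 2 + ordAt f x

/-- The enhanced-level-graph invariant `k(ζ) = -s_ζ(f) - 1` of a tangent direction. -/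
noncomputable def kVal (f : G → ℝ) {v : G} (ζ : TangentDir v) : ℤ :=
  -(tangentSlope f ζ) - 1

/-- `v` is an inconvenient vertex of the enhanced level graph `Γ⁺(f)` (all vertex
weights `h ≡ 0`): no `k`-value equals `-1`, and some `k`-value (of a half-edge, or of
one of the `D(v)` attached legs, which carry `k = 1`) exceeds
`Σ_{k_j < 0} (-k_j) - #{k_j < 0} - 1`.  (Legs have `k = 1 > 0` and so never contribute
to the sums, and their `k`-value is `≠ -1`.) -/
def Inconvenient (val : G → ℕ) (f : G → ℝ) (v : G) : Prop :=
  (∀ ζ : TangentDir v, kVal f ζ ≠ -1) ∧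
  ∃ k₀ : ℤ, ((∃ ζ : TangentDir v, kVal f ζ = k₀) ∨ (0 < canDiv val f v ∧ k₀ = 1)) ∧
    (∑ᶠ ζ ∈ {ζ : TangentDir v | kVal f ζ < 0}, (-kVal f ζ))
      - (({ζ : TangentDir v | kVal f ζ < 0}).ncard : ℤ) - 1 < k₀

/-- The realizability criterion of Möller–Ulirsch–Werner for the effective canonical
divisor `K + div f`: every inconvenient vertex, and every open arc on which `f` is
constant, away from the bends of `f` and from higher-valence points, is contained in a
simple cycle lying above it. -/
def RealizableFn (val : G → ℕ) (f : G → ℝ) : Prop :=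
  (∀ v, Inconvenient val f v →
    ∃ Z : Set G, IsCycleSet Z ∧ v ∈ Z ∧ ∀ z ∈ Z, f v ≤ f z) ∧
  (∀ A : Set G, IsOpenArc A → ConstOn f A → (∀ x ∈ A, ordAt f x = 0 ∧ val x = 2) →
    ∃ Z : Set G, IsCycleSet Z ∧ A ⊆ Z ∧ ∀ z ∈ Z, ∀ a ∈ A, f a ≤ f z)

/-- The realizability locus inside the canonical linear system. -/
def RealSet (val : G → ℕ) : Set (G → ℤ) :=
  {D | ∃ f : G → ℝ, IsRational f ∧ (∀ x, D x = (val x : ℤ) - 2 + ordAt f x) ∧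
    RealizableFn val f}

/-! ### Tropical linear series -/

/-- The cone `R(𝔡, D)` of rational functions `f` with `D + div f ∈ 𝔡`. -/
def coneOf (D : G → ℤ) (𝔡 : Set (G → ℤ)) : Set (G → ℝ) :=
  {f | IsRational f ∧ (fun x => D x + ordAt f x) ∈ 𝔡}

/-- A tropical linear series: a tropically convex subset of a complete linear system,
i.e. one whose cone of rational functions is a tropical submodule. -/
def TropLinearSeries (D₀ : G → ℤ) (𝔡 : Set (G → ℤ)) : Prop :=
  𝔡 ⊆ LinSys D₀ ∧
  (∀ f ∈ coneOf D₀ 𝔡, ∀ g ∈ coneOf D₀ 𝔡, (fun x => max (f x) (g x)) ∈ coneOf D₀ 𝔡) ∧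
  (∀ c : ℝ, ∀ f ∈ coneOf D₀ 𝔡, (fun x => c + f x) ∈ coneOf D₀ 𝔡)

/-- The rank of the tropical linear series `𝔡` is at least `d`:
`𝔡(-E)` is nonempty for every effective divisor `E` of degree `d`. -/
def lsRankGe (𝔡 : Set (G → ℤ)) (d : ℕ) : Prop :=
  ∀ E : G → ℤ, FinSupp E → Effective E → deg E = (d : ℤ) →
    ∃ D ∈ 𝔡, ∀ x, E x ≤ D x

/-- `D` splits in `𝔡`: some non-constant `f ∈ R(𝔡, D)`, with maximum locus `Z`, has a
boundary point `x ∈ ∂Z` with `D(x) + ord_x(f) > 0`. -/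
def Splits (𝔡 : Set (G → ℤ)) (D : G → ℤ) : Prop :=
  ∃ f ∈ coneOf D 𝔡, (¬∀ x y : G, f x = f y) ∧
    ∃ x ∈ frontier {y | ∀ z, f z ≤ f y}, 0 < D x + ordAt f x

/-- The pairing of a divisor with a test function. -/
noncomputable def pairing (D : G → ℤ) (φ : G → ℝ) : ℝ :=
  ∑ᶠ x, (D x : ℝ) * φ x

/-- The tangent space of `X` at `D` has dimension at least `r`: there are `r`
one-sided differentiable paths through `D` inside `X` whose derivatives (as linear
functionals on rational test functions) are linearly independent. -/
def TangentDimGe (X : Set (G → ℤ)) (D : G → ℤ) (r : ℕ) : Prop :=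
  ∃ (c : Fin r → ℝ → G → ℤ) (L : Fin r → (G → ℝ) → ℝ) (ε : ℝ), 0 < ε ∧
    (∀ i, c i 0 = D) ∧ (∀ i, ∀ t ∈ Set.Ico (0:ℝ) ε, c i t ∈ X) ∧
    (∀ i, ∀ φ : G → ℝ, IsRational φ →
      HasDerivWithinAt (fun t => pairing (c i t) φ) (L i φ) (Set.Ici 0) 0) ∧
    LinearIndependent ℝ L

/-! ### Length spaces -/

theorem edist_add_edist_le_pathLength {p q : G} (g : Path p q) {τ : ℝ} (hτ : τ ∈ Icc (0:ℝ) 1) :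
    edist p (g.extend τ) + edist (g.extend τ) q ≤ pathLength g := by
  have h := eVariationOn.Icc_add_Icc (fun t : ℝ => g.extend t) hτ.1 hτ.2
    (s := univ) (mem_univ _)
  simp only [univ_inter] at h
  unfold pathLength
  rw [← h]
  gcongr
  · have := eVariationOn.edist_le (fun t : ℝ => g.extend t) (s := Icc 0 τ)
      (left_mem_Icc.2 hτ.1) (right_mem_Icc.2 hτ.1)
    simpa using this
  · have := eVariationOn.edist_le (fun t : ℝ => g.extend t) (s := Icc τ 1)
      (left_mem_Icc.2 hτ.2) (right_mem_Icc.2 hτ.2)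
    simpa using this

theorem exists_path_length_lt (hlen : ∀ x y : G, edist x y = ⨅ g : Path x y, pathLength g)
    {p q : G} {L : ℝ} (h : dist p q < L) :
    ∃ g : Path p q, ∀ τ ∈ Icc (0:ℝ) 1, dist p (g.extend τ) + dist (g.extend τ) q < L := by
  have h' : edist p q < ENNReal.ofReal L := by
    rw [edist_dist]
    exact (ENNReal.ofReal_lt_ofReal_iff (dist_nonneg.trans_lt h)).2 h
  rw [hlen, iInf_lt_iff] at h'
  obtain ⟨g, hg⟩ := h'
  refine ⟨g, fun τ hτ => ?_⟩
  have := (edist_add_edist_le_pathLength g hτ).trans_lt hg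
  rw [edist_dist, edist_dist, ← ENNReal.ofReal_add dist_nonneg dist_nonneg] at this
  exact (ENNReal.ofReal_lt_ofReal_iff (dist_nonneg.trans_lt h)).1 this

/-- A point separating two nearby points lies between them metrically. -/
theorem dist_eq_add_of_separates
    (hlen : ∀ x y : G, edist x y = ⨅ g : Path x y, pathLength g)
    {x p q z : G} {ρ a : ℝ} {U : Set G} (hU : Metric.ball x (3 * ρ) ⊆ U)
    (hp : dist p x < ρ) (hq : dist q x < ρ) {c : G → ℝ} (hc : ContinuousOn c U)
    (hz : ∀ w ∈ U, c w = a → w = z) (h1 : c p ≤ a) (h2 : a ≤ c q) :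
    dist p q = dist p z + dist z q := by
  refine le_antisymm (dist_triangle _ _ _) (not_lt.1 fun hlt => ?_)
  have h2ρ : dist p q < 2 * ρ := by
    have := dist_triangle_right p q x
    linarith
  obtain ⟨g, hg⟩ := exists_path_length_lt hlen (lt_min h2ρ hlt)
  have hmem : ∀ τ ∈ Icc (0:ℝ) 1, g.extend τ ∈ U := fun τ hτ => hU <| by
    have h := (hg τ hτ).trans_le (min_le_left _ _)
    rw [Metric.mem_ball]
    have h3 := dist_triangle (g.extend τ) p x
    rw [dist_comm (g.extend τ) p] at h3
    have := dist_nonneg (x := g.extend τ) (y := q)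
    linarith
  have hcont : ContinuousOn (fun τ => c (g.extend τ)) (Icc 0 1) :=
    hc.comp (g.continuous_extend).continuousOn hmem
  obtain ⟨τ, hτ, hcτ⟩ := intermediate_value_Icc zero_le_one hcont
    (show a ∈ Icc (c (g.extend 0)) (c (g.extend 1)) by simpa using ⟨h1, h2⟩)
  have := hz _ (hmem τ hτ) hcτ
  have h := (hg τ hτ).trans_le (min_le_right _ _)
  rw [this] at h
  exact lt_irrefl _ h

/-- In a length space, a function that is 1-Lipschitz at every point is 1-Lipschitz. -/
theorem abs_sub_le_dist_of_eventually
    (hlen : ∀ x y : G, edist x y = ⨅ g : Path x y, pathLength g)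
    {F : G → ℝ} (hF : ∀ y, ∀ᶠ z in nhds y, |F z - F y| ≤ dist z y) (p q : G) :
    |F p - F q| ≤ dist p q := by
  have hcont : Continuous F := continuous_iff_continuousAt.2 fun y => by
    rw [ContinuousAt, tendsto_iff_dist_tendsto_zero]
    refine squeeze_zero' (Filter.Eventually.of_forall fun _ => dist_nonneg) (hF y) ?_
    exact tendsto_iff_dist_tendsto_zero.1 Filter.tendsto_id
  have key : ∀ g : Path p q, edist (F p) (F q) ≤ pathLength g := by
    intro g
    set V : ℝ → ℝ≥0∞ := fun t => eVariationOn (fun t : ℝ => g.extend t) (Icc 0 t) with hV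
    have hVmono : Monotone V := fun s t hst => eVariationOn.mono _ (Icc_subset_Icc_right hst)
    set S : Set ℝ := {t | t ∈ Icc (0:ℝ) 1 ∧ edist (F p) (F (g.extend t)) ≤ V t} with hS
    have h0 : (0:ℝ) ∈ S := ⟨by simp, by simp⟩
    have hbdd : BddAbove S := ⟨1, fun t ht => ht.1.2⟩
    set T := sSup S with hT
    have hT01 : T ∈ Icc (0:ℝ) 1 := ⟨le_csSup hbdd h0, csSup_le ⟨0, h0⟩ fun t ht => ht.1.2⟩
    have hgc : Continuous fun t : ℝ => F (g.extend t) := hcont.comp g.continuous_extend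
    have hTS : T ∈ S := by
      refine ⟨hT01, ?_⟩
      have hcl : T ∈ closure S := csSup_mem_closure ⟨0, h0⟩ hbdd
      have hcl' : IsClosed {t : ℝ | edist (F p) (F (g.extend t)) ≤ V T} :=
        isClosed_le (continuous_const.edist hgc) continuous_const
      exact closure_minimal (fun t ht => ht.2.trans (hVmono (le_csSup hbdd ht))) hcl' hcl
    rcases hT01.2.eq_or_lt with h1 | h1
    · have := hTS.2
      rw [h1] at this
      simpa [hV, pathLength] using this
    · exfalso
      have hev := (g.continuous_extend.tendsto T).eventually (hF (g.extend T))
      have hev' : ∀ᶠ t in nhdsWithin T (Ioi T), t ∈ Ioo T 1 ∧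
          |F (g.extend t) - F (g.extend T)| ≤ dist (g.extend t) (g.extend T) :=
        (Ioo_mem_nhdsGT h1 : _ ∈ nhdsWithin T (Ioi T)) |> fun h =>
          (Filter.eventually_of_mem h fun _ ht => ht).and (hev.filter_mono nhdsWithin_le_nhds)
      obtain ⟨t, ht, hFt⟩ := hev'.exists
      have htS : t ∈ S := by
        refine ⟨⟨hT01.1.trans ht.1.le, ht.2.le⟩, ?_⟩
        have hadd := eVariationOn.Icc_add_Icc (fun t : ℝ => g.extend t) hT01.1 ht.1.le
          (s := univ) (mem_univ _)
        simp only [univ_inter] at hadd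
        calc edist (F p) (F (g.extend t))
            ≤ edist (F p) (F (g.extend T)) + edist (F (g.extend T)) (F (g.extend t)) :=
              edist_triangle _ _ _
          _ ≤ V T + edist (g.extend T) (g.extend t) := by
              gcongr
              · exact hTS.2
              · rw [edist_comm, edist_comm (g.extend T), edist_dist, edist_dist, Real.dist_eq]
                exact ENNReal.ofReal_le_ofReal hFt
          _ ≤ V t := by
              rw [hV]
              simp only
              rw [← hadd]
              gcongr
              exact eVariationOn.edist_le (fun t : ℝ => g.extend t) (s := Icc T t)
                (left_mem_Icc.2 ht.1.le) (right_mem_Icc.2 ht.1.le)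
      exact absurd (le_csSup hbdd htS) (not_le.2 ht.1)
  have : edist (F p) (F q) ≤ edist p q := by
    rw [hlen p q]
    exact le_iInf key
  rw [edist_dist, edist_dist, ENNReal.ofReal_le_ofReal_iff dist_nonneg] at this
  rwa [Real.dist_eq] at this

/-! ### Star charts -/

/-- A metric star centred at `x`: the ball of radius `r` is the union of the `v` branches
`γ i '' [0, r)`, glued at `x`, with its intrinsic metric. -/
structure IsStarChart (x : G) {v : ℕ} (r : ℝ) (γ : Fin v → ℝ → G) : Prop where
  pos : 0 < r
  zero : ∀ i, γ i 0 = x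
  dist_same : ∀ i, ∀ s ∈ Ico (0:ℝ) r, ∀ t ∈ Ico (0:ℝ) r, dist (γ i s) (γ i t) = |s - t|
  dist_ne : ∀ i j, i ≠ j → ∀ s ∈ Ico (0:ℝ) r, ∀ t ∈ Ico (0:ℝ) r,
    dist (γ i s) (γ j t) = s + t
  surj : ∀ z, dist z x < r → ∃ i, ∃ t ∈ Ico (0:ℝ) r, γ i t = z

/-- The signed distance from the centre of a star, positive exactly on the branch `i`. -/
def starCoord {v : ℕ} {ε : ℝ} (i : Fin v) : StarGlue v ε → ℝ :=
  Quotient.lift (fun p : Fin v × Ico (0:ℝ) ε => if p.1 = i then (p.2 : ℝ) else -p.2) <| by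
    rintro a b (rfl | ⟨ha, hb⟩)
    · rfl
    · simp [ha, hb]

theorem continuous_starCoord {v : ℕ} {ε : ℝ} (i : Fin v) :
    Continuous (starCoord i : StarGlue v ε → ℝ) := by
  refine Continuous.quotient_lift ?_ _
  refine continuous_prod_of_discrete_left.2 fun j => ?_
  by_cases h : j = i
  · simpa [h] using continuous_subtype_val
  · simp only [h, if_false]
    fun_prop

/-- The distance from the centre of a star. -/
def starRadius {v : ℕ} {ε : ℝ} : StarGlue v ε → ℝ :=
  Quotient.lift (fun p : Fin v × Ico (0:ℝ) ε => (p.2 : ℝ)) <| by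
    rintro a b (rfl | ⟨ha, hb⟩)
    · rfl
    · simp [ha, hb]

theorem continuous_starRadius {v : ℕ} {ε : ℝ} :
    Continuous (starRadius : StarGlue v ε → ℝ) :=
  Continuous.quotient_lift (continuous_subtype_val.comp continuous_snd) _

open scoped Classical in
theorem exists_isStarChart (hG : IsMetricGraph G) (x : G) :
    ∃ (v : ℕ) (r : ℝ) (γ : Fin v → ℝ → G), IsStarChart x r γ := by
  obtain ⟨-, hlen, hstar⟩ := hG
  obtain ⟨v, U, hU, ε, hε, φ, hxU, hx⟩ := hstar x
  obtain ⟨R, hR, hRU⟩ := Metric.mem_nhds_iff.1 hU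
  set ρ := R / 3 with hρ
  have hρU : Metric.ball x (3 * ρ) ⊆ U := by
    rw [hρ, mul_div_cancel₀ _ (by norm_num : (3:ℝ) ≠ 0)]
    exact hRU
  set q : Fin v → Ico (0:ℝ) ε → StarGlue v ε := fun i t => Quotient.mk (starSetoid v ε) (i, t)
    with hq
  have hqc : ∀ i, Continuous (q i) := fun i =>
    continuous_quotient_mk'.comp (Continuous.prodMk_right i)
  set β : Fin v → ℝ → G := fun i t => if h : t ∈ Ico 0 ε then (φ.symm (q i ⟨t, h⟩) : G) else x
    with hβ
  have hβt : ∀ i t (h : t ∈ Ico 0 ε), β i t = φ.symm (q i ⟨t, h⟩) := fun i t h => dif_pos h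
  have hβU : ∀ i, ∀ t ∈ Ico (0:ℝ) ε, β i t ∈ U := fun i t h => by
    rw [hβt i t h]; exact Subtype.coe_prop _
  have hφβ : ∀ i t (h : t ∈ Ico 0 ε) (h' : β i t ∈ U), φ ⟨β i t, h'⟩ = q i ⟨t, h⟩ :=
    fun i t h h' => by
      have : (⟨β i t, h'⟩ : U) = φ.symm (q i ⟨t, h⟩) := Subtype.ext (hβt i t h)
      rw [this, φ.apply_symm_apply]
  have h0ε : (0:ℝ) ∈ Ico 0 ε := ⟨le_rfl, hε⟩
  have hβ0 : ∀ i, β i 0 = x := fun i => by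
    rw [hβt i 0 h0ε, hq]
    simp only
    rw [← hx i, φ.symm_apply_apply]
  have hβc : ∀ i, ContinuousOn (β i) (Ico 0 ε) := fun i => by
    rw [continuousOn_iff_continuous_domRestrict]
    have : (Ico 0 ε).domRestrict (β i) = fun t => (φ.symm (q i t) : G) := by
      funext t
      exact hβt i t t.2
    rw [this]
    exact continuous_subtype_val.comp (φ.symm.continuous.comp (hqc i))
  set crd : Fin v → G → ℝ := fun i w => if h : w ∈ U then starCoord i (φ ⟨w, h⟩) else 0 with hcrd
  have hcrdc : ∀ i, ContinuousOn (crd i) U := fun i => by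
    rw [continuousOn_iff_continuous_domRestrict]
    have : U.domRestrict (crd i) = fun w => starCoord i (φ w) := by
      funext w
      exact dif_pos w.2
    rw [this]
    exact (continuous_starCoord i).comp φ.continuous
  have hcrdβ : ∀ i j, ∀ t ∈ Ico (0:ℝ) ε, crd i (β j t) = if j = i then t else -t :=
    fun i j t h => by
      have h' := hβU j t h
      rw [hcrd]
      simp only [dif_pos h']
      rw [hφβ j t h h']
      rfl
  have hcrdi : ∀ i, ∀ t ∈ Ico (0:ℝ) ε, crd i (β i t) = t := fun i t h => by
    rw [hcrdβ i i t h, if_pos rfl]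
  have hrep : ∀ w (h : w ∈ U), ∃ (j : Fin v) (t : ℝ) (ht : t ∈ Ico 0 ε),
      w = β j t ∧ φ ⟨w, h⟩ = q j ⟨t, ht⟩ := fun w h => by
    obtain ⟨⟨j, t⟩, hjt⟩ := Quotient.exists_rep (φ ⟨w, h⟩)
    refine ⟨j, t, t.2, ?_, hjt.symm⟩
    rw [hβt j t t.2, hq]
    simp only
    rw [hjt, φ.symm_apply_apply]
  have hsep : ∀ i, ∀ a ∈ Ico (0:ℝ) ε, ∀ w ∈ U, crd i w = a → w = β i a := by
    intro i a ha w hw hwa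
    obtain ⟨j, t, ht, rfl, -⟩ := hrep w hw
    rw [hcrdβ i j t ht] at hwa
    split_ifs at hwa with hji
    · rw [hji, hwa]
    · have h1 := ht.1
      have h2 := ha.1
      have ht0 : t = 0 := by linarith
      have ha0 : a = 0 := by linarith
      rw [ht0, ha0, hβ0, hβ0]
  obtain ⟨t₁, ht₁, ht₁ε, hnear⟩ : ∃ t₁ > 0, t₁ < ε ∧ ∀ i, ∀ t ∈ Icc 0 t₁, dist (β i t) x < ρ := by
    have hev : ∀ᶠ t in nhdsWithin (0:ℝ) (Ici 0), ∀ i, dist (β i t) x < ρ := by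
      rw [Filter.eventually_all]
      intro i
      have h1 : ContinuousWithinAt (β i) (Ici 0) 0 := by
        refine (hβc i 0 h0ε).mono_of_mem_nhdsWithin ?_
        exact Ico_mem_nhdsGE hε
      have h2 := h1.eventually (Metric.ball_mem_nhds (β i 0) (by rw [hρ]; linarith : 0 < ρ))
      filter_upwards [h2] with t ht
      rw [hβ0] at ht
      exact ht
    obtain ⟨u, hu, hsub⟩ := mem_nhdsGE_iff_exists_Icc_subset.1 hev
    refine ⟨min u (ε / 2), lt_min hu (by linarith), (min_le_right _ _).trans_lt (by linarith),
      fun i t ht => hsub ⟨ht.1, ht.2.trans (min_le_left _ _)⟩ i⟩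
  have hIco : ∀ t ∈ Icc 0 t₁, t ∈ Ico 0 ε := fun t ht => ⟨ht.1, ht.2.trans_lt ht₁ε⟩
  have h0t : (0:ℝ) ∈ Icc 0 t₁ := ⟨le_rfl, ht₁.le⟩
  have hdne : ∀ i j, i ≠ j → ∀ s ∈ Icc 0 t₁, ∀ t ∈ Icc 0 t₁,
      dist (β i s) (β j t) = dist x (β i s) + dist x (β j t) := by
    intro i j hij s hs t ht
    rw [dist_comm x (β i s)]
    refine dist_eq_add_of_separates hlen hρU (hnear i s hs) (hnear j t ht) (hcrdc j) (a := 0)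
      (fun w hw hw0 => ?_) ?_ ?_
    · rw [hsep j 0 h0ε w hw hw0, hβ0]
    · rw [hcrdβ j i s (hIco s hs), if_neg hij]
      linarith [hs.1]
    · rw [hcrdi j t (hIco t ht)]
      exact ht.1
  have hdsame : ∀ i, ∀ s ∈ Icc 0 t₁, ∀ t ∈ Icc 0 t₁, s ≤ t →
      dist x (β i t) = dist x (β i s) + dist (β i s) (β i t) := by
    intro i s hs t ht hst
    refine dist_eq_add_of_separates hlen hρU (by rw [dist_self, hρ]; linarith) (hnear i t ht)
      (hcrdc i) (hsep i s (hIco s hs)) ?_ ?_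
    · rw [← hβ0 i, hcrdi i 0 h0ε]
      exact hs.1
    · rwa [hcrdi i t (hIco t ht)]
  have hdabs : ∀ i, ∀ s ∈ Icc 0 t₁, ∀ t ∈ Icc 0 t₁,
      dist (β i s) (β i t) = |dist x (β i s) - dist x (β i t)| := by
    intro i s hs t ht
    rcases le_total s t with hst | hst
    · rw [hdsame i s hs t ht hst, abs_sub_comm, add_sub_cancel_left, abs_of_nonneg dist_nonneg]
    · rw [hdsame i t ht s hs hst, add_sub_cancel_left, abs_of_nonneg dist_nonneg, dist_comm]
  obtain ⟨r, hr, hrd, hrU⟩ : ∃ r > 0, (∀ i, r ≤ dist x (β i t₁)) ∧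
      ∀ w, dist w x < r → ∃ i, ∃ t ∈ Icc 0 t₁, w = β i t := by
    have hW : ∀ᶠ w in nhds x, ∃ i, ∃ t ∈ Icc 0 t₁, w = β i t := by
      set rad : G → ℝ := fun w => if h : w ∈ U then starRadius (φ ⟨w, h⟩) else 0 with hrad
      have hradc : ContinuousOn rad U := by
        rw [continuousOn_iff_continuous_domRestrict]
        have : U.domRestrict rad = fun w => starRadius (φ w) := by
          funext w
          exact dif_pos w.2
        rw [this]
        exact continuous_starRadius.comp φ.continuous
      have hradβ : ∀ j t (ht : t ∈ Ico 0 ε), rad (β j t) = t := fun j t ht => by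
        have h' := hβU j t ht
        rw [hrad]
        simp only [dif_pos h']
        rw [hφβ j t ht h']
        rfl
      obtain ⟨j, -⟩ := hrep x hxU
      have hev := (hradc.continuousAt hU).eventually
        (gt_mem_nhds (show rad x < t₁ by rw [← hβ0 j, hradβ j 0 h0ε]; exact ht₁))
      filter_upwards [hev, hU] with w hw hwU
      obtain ⟨i, t, ht, rfl, -⟩ := hrep w hwU
      rw [hradβ i t ht] at hw
      exact ⟨i, t, ⟨ht.1, hw.le⟩, rfl⟩
    obtain ⟨r₀, hr₀, hball⟩ := Metric.eventually_nhds_iff.1 hW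
    have hpos : ∀ i, 0 < dist x (β i t₁) := fun i => dist_pos.2 fun h => by
      have h1 := hcrdi i t₁ ⟨ht₁.le, ht₁ε⟩
      rw [← h, ← hβ0 i, hcrdi i 0 h0ε] at h1
      exact ht₁.ne h1
    have hev : ∀ᶠ r in nhdsWithin (0:ℝ) (Ioi 0), 0 < r ∧ r ≤ r₀ ∧ ∀ i, r ≤ dist x (β i t₁) := by
      refine (Filter.eventually_mem_set.2 self_mem_nhdsWithin).and (.and ?_ ?_)
      · exact (eventually_le_nhds hr₀).filter_mono nhdsWithin_le_nhds
      · exact Filter.eventually_all.2 fun i =>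
          (eventually_le_nhds (hpos i)).filter_mono nhdsWithin_le_nhds
    obtain ⟨r, hr, hr1, hr2⟩ := hev.exists
    exact ⟨r, hr, hr2, fun w hw => hball (hw.trans_le hr1)⟩
  have hivt : ∀ i, ∀ s, ∃ t, s ∈ Ico 0 r → t ∈ Icc 0 t₁ ∧ dist x (β i t) = s := by
    intro i s
    by_cases hs : s ∈ Ico 0 r
    · have hc : ContinuousOn (fun t => dist x (β i t)) (Icc 0 t₁) :=
        (continuous_const.dist continuous_id).comp_continuousOn
          ((hβc i).mono hIco)
      obtain ⟨t, ht, hts⟩ := intermediate_value_Icc ht₁.le hc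
        (show s ∈ Icc (dist x (β i 0)) (dist x (β i t₁)) by
          rw [hβ0, dist_self]; exact ⟨hs.1, hs.2.le.trans (hrd i)⟩)
      exact ⟨t, fun _ => ⟨ht, hts⟩⟩
    · exact ⟨0, fun h => absurd h hs⟩
  choose T hT using hivt
  refine ⟨v, r, fun i s => β i (T i s), hr, fun i => ?_, ?_, ?_, ?_⟩
  · exact (dist_eq_zero.1 (hT i 0 ⟨le_rfl, hr⟩).2).symm
  · intro i s hs t ht
    rw [hdabs i _ (hT i s hs).1 _ (hT i t ht).1, (hT i s hs).2, (hT i t ht).2]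
  · intro i j hij s hs t ht
    rw [hdne i j hij _ (hT i s hs).1 _ (hT j t ht).1, (hT i s hs).2, (hT j t ht).2]
  · intro z hz
    obtain ⟨i, t, ht, rfl⟩ := hrU z hz
    have hmem : dist x (β i t) ∈ Ico 0 r := ⟨dist_nonneg, by rwa [dist_comm]⟩
    refine ⟨i, dist x (β i t), hmem, ?_⟩
    rw [← dist_eq_zero, hdabs i _ (hT i _ hmem).1 _ ht, (hT i _ hmem).2, sub_self, abs_zero]

namespace IsStarChart

variable {x : G} {v : ℕ} {r : ℝ} {γ : Fin v → ℝ → G}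

theorem zero_mem (h : IsStarChart x r γ) : (0:ℝ) ∈ Ico 0 r := ⟨le_rfl, h.pos⟩

theorem dist_center (h : IsStarChart x r γ) (i : Fin v) {t : ℝ} (ht : t ∈ Ico 0 r) :
    dist (γ i t) x = t := by
  have := h.dist_same i t ht 0 h.zero_mem
  rwa [h.zero, sub_zero, abs_of_nonneg ht.1] at this

theorem mono (h : IsStarChart x r γ) {r' : ℝ} (hr' : 0 < r') (hle : r' ≤ r) :
    IsStarChart x r' γ := by
  have hsub : ∀ t ∈ Ico (0:ℝ) r', t ∈ Ico 0 r := fun t ht => ⟨ht.1, ht.2.trans_le hle⟩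
  refine ⟨hr', h.zero, fun i s hs t ht => h.dist_same i s (hsub s hs) t (hsub t ht),
    fun i j hij s hs t ht => h.dist_ne i j hij s (hsub s hs) t (hsub t ht), fun z hz => ?_⟩
  obtain ⟨i, t, ht, rfl⟩ := h.surj z (hz.trans_le hle)
  rw [h.dist_center i ht] at hz
  exact ⟨i, t, ⟨ht.1, hz⟩, rfl⟩

theorem isUnitSpeedFrom (h : IsStarChart x r γ) (i : Fin v) : IsUnitSpeedFrom x r (γ i) :=
  ⟨h.zero i, h.dist_same i⟩

theorem continuousOn (h : IsStarChart x r γ) (i : Fin v) : ContinuousOn (γ i) (Ico 0 r) := by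
  have : LipschitzOnWith 1 (γ i) (Ico 0 r) := LipschitzOnWith.of_dist_le_mul fun s hs t ht => by
    rw [h.dist_same i s hs t ht, Real.dist_eq, NNReal.coe_one, one_mul]
  exact this.continuousOn

theorem nonempty (h : IsStarChart x r γ) : Nonempty (Fin v) := by
  obtain ⟨i, -⟩ := h.surj x (by rw [dist_self]; exact h.pos)
  exact ⟨i⟩

/-- Every unit speed path starts along one of the branches of a star chart. -/
theorem exists_branch_eq (h : IsStarChart x r γ) {ε : ℝ} (hε : 0 < ε) {g : ℝ → G}
    (hg : IsUnitSpeedFrom x ε g) :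
    ∃ i, ∃ δ > 0, ∀ t ∈ Ico (0:ℝ) δ, g t = γ i t := by
  have hδ : 0 < min r ε := lt_min h.pos hε
  have hb : ∀ t ∈ Ico 0 (min r ε), ∃ i, g t = γ i t := by
    intro t ht
    have hd := hg.2 t ⟨ht.1, ht.2.trans_le (min_le_right _ _)⟩ 0 ⟨le_rfl, hε⟩
    rw [hg.1, sub_zero, abs_of_nonneg ht.1] at hd
    obtain ⟨i, s, hs, hgs⟩ := h.surj (g t) (by rw [hd]; exact ht.2.trans_le (min_le_left _ _))
    rw [← hgs, h.dist_center i hs] at hd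
    exact ⟨i, by rw [← hgs, hd]⟩
  obtain ⟨i, hi⟩ := hb (min r ε / 2) ⟨by linarith, by linarith⟩
  refine ⟨i, min r ε, hδ, fun t ht => ?_⟩
  obtain ⟨j, hj⟩ := hb t ht
  rcases ht.1.eq_or_lt with rfl | h0
  · rw [hg.1, h.zero]
  by_cases hij : i = j
  · rw [hij]; exact hj
  · exfalso
    have hm : min r ε / 2 ∈ Ico 0 (min r ε) := ⟨by linarith, by linarith⟩
    have h1 := h.dist_ne i j hij _ ⟨hm.1, hm.2.trans_le (min_le_left _ _)⟩ t
      ⟨ht.1, ht.2.trans_le (min_le_left _ _)⟩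
    rw [← hi, ← hj, hg.2 _ ⟨hm.1, hm.2.trans_le (min_le_right _ _)⟩ t
      ⟨ht.1, ht.2.trans_le (min_le_right _ _)⟩] at h1
    have : |min r ε / 2 - t| < min r ε / 2 + t := by
      rw [abs_lt]
      constructor <;> linarith
    exact this.ne h1

/-- The tangent direction of a branch. -/
def dir (h : IsStarChart x r γ) (i : Fin v) : TangentDir x :=
  Quotient.mk (germSetoid x) ⟨γ i, r, h.pos, h.isUnitSpeedFrom i⟩

theorem dir_bijective (h : IsStarChart x r γ) : Bijective h.dir := by
  constructor
  · intro i j hij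
    obtain ⟨δ, hδ, heq⟩ := Quotient.exact hij
    by_contra hne
    set t := min δ r / 2 with ht
    have h0 : 0 < min δ r := lt_min hδ h.pos
    have htm : t ∈ Ico 0 (min δ r) := ⟨by linarith, by linarith⟩
    have htr : t ∈ Ico 0 r := ⟨htm.1, htm.2.trans_le (min_le_right _ _)⟩
    have h1 := h.dist_ne i j hne t htr t htr
    have h2 : γ i t = γ j t := heq t ⟨htm.1, htm.2.trans_le (min_le_left _ _)⟩
    rw [h2, dist_self] at h1
    linarith
  · intro ζ
    obtain ⟨⟨g, ε, hε, hg⟩, rfl⟩ := Quotient.exists_rep ζ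
    obtain ⟨i, δ, hδ, heq⟩ := h.exists_branch_eq hε hg
    exact ⟨i, Quotient.sound ⟨δ, hδ, fun t ht => (heq t ht).symm⟩⟩

end IsStarChart

theorem HasSlopeAlong.congr {X : Type*} {f : X → ℝ} {g₁ g₂ : ℝ → X} {s : ℤ} (h : HasSlopeAlong f g₁ s)
    (hg : ∃ δ > (0:ℝ), ∀ t ∈ Ico (0:ℝ) δ, g₁ t = g₂ t) : HasSlopeAlong f g₂ s := by
  obtain ⟨δ, hδ, h⟩ := h
  obtain ⟨δ', hδ', hg⟩ := hg
  refine ⟨min δ δ', lt_min hδ hδ', fun t ht => ?_⟩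
  rw [← hg t ⟨ht.1, ht.2.trans_le (min_le_right _ _)⟩, ← hg 0 ⟨le_rfl, hδ'⟩]
  exact h t ⟨ht.1, ht.2.trans_le (min_le_left _ _)⟩

theorem HasSlopeAlong.unique {X : Type*} {f : X → ℝ} {g : ℝ → X} {s s' : ℤ} (h : HasSlopeAlong f g s)
    (h' : HasSlopeAlong f g s') : s = s' := by
  obtain ⟨δ, hδ, h⟩ := h
  obtain ⟨δ', hδ', h'⟩ := h'
  have h0 : 0 < min δ δ' := lt_min hδ hδ'
  have htm : min δ δ' / 2 ∈ Ico 0 (min δ δ') := ⟨by linarith, by linarith⟩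
  have h1 := h _ ⟨htm.1, htm.2.trans_le (min_le_left _ _)⟩
  have h2 := h' _ ⟨htm.1, htm.2.trans_le (min_le_right _ _)⟩
  have h3 : (s : ℝ) * (min δ δ' / 2) = s' * (min δ δ' / 2) := by linarith
  exact_mod_cast mul_right_cancel₀ (by positivity : min δ δ' / 2 ≠ 0) h3

theorem HasSlopeAlong.add {X : Type*} {f f' : X → ℝ} {g : ℝ → X} {s s' : ℤ} (h : HasSlopeAlong f g s)
    (h' : HasSlopeAlong f' g s') : HasSlopeAlong (fun y => f y + f' y) g (s + s') := by
  obtain ⟨δ, hδ, h⟩ := h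
  obtain ⟨δ', hδ', h'⟩ := h'
  refine ⟨min δ δ', lt_min hδ hδ', fun t ht => ?_⟩
  beta_reduce
  rw [h _ ⟨ht.1, ht.2.trans_le (min_le_left _ _)⟩, h' _ ⟨ht.1, ht.2.trans_le (min_le_right _ _)⟩]
  push_cast
  ring

theorem tangentSlope_eq {f : G → ℝ} {x : G} {ζ : TangentDir x} {s : ℤ}
    (h : HasSlopeAlong f (Quotient.out ζ).1 s) : tangentSlope f ζ = s := by
  have hex : ∃ s : ℤ, HasSlopeAlong f (Quotient.out ζ).1 s := ⟨s, h⟩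
  rw [tangentSlope, dif_pos hex]
  exact hex.choose_spec.unique h

namespace IsStarChart

variable {x : G} {v : ℕ} {r : ℝ} {γ : Fin v → ℝ → G}

theorem ordAt_eq (h : IsStarChart x r γ) {f : G → ℝ} {σ : Fin v → ℤ}
    (hσ : ∀ i, HasSlopeAlong f (γ i) (σ i)) : ordAt f x = ∑ i, σ i := by
  have h1 : ∀ i, tangentSlope f (h.dir i) = σ i := by
    intro i
    refine tangentSlope_eq ((hσ i).congr ?_)
    obtain ⟨δ, hδ, heq⟩ := Quotient.exact (Quotient.out_eq (h.dir i))
    exact ⟨δ, hδ, fun t ht => (heq t ht).symm⟩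
  rw [ordAt, ← finsum_eq_sum_of_fintype]
  exact (finsum_eq_of_bijective h.dir h.dir_bijective fun i => (h1 i).symm).symm

theorem exists_slopes (h : IsStarChart x r γ) {f : G → ℝ} (hf : IsRational f) :
    ∃ σ : Fin v → ℤ, ∀ i, HasSlopeAlong f (γ i) (σ i) := by
  choose σ hσ using fun i => hf.2 x r (γ i) h.pos (h.isUnitSpeedFrom i)
  exact ⟨σ, hσ⟩

theorem exists_linear (h : IsStarChart x r γ) {f : G → ℝ} (hf : IsRational f) :
    ∃ (σ : Fin v → ℤ) (r' : ℝ), 0 < r' ∧ r' ≤ r ∧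
      ∀ i, ∀ t ∈ Ico (0:ℝ) r', f (γ i t) = f x + σ i * t := by
  obtain ⟨σ, hσ⟩ := h.exists_slopes hf
  choose δ hδ hlin using hσ
  have hev : ∀ᶠ r' in nhdsWithin (0:ℝ) (Ioi 0), 0 < r' ∧ r' ≤ r ∧ ∀ i, r' ≤ δ i := by
    refine (Filter.eventually_mem_set.2 self_mem_nhdsWithin).and (.and ?_ ?_)
    · exact (eventually_le_nhds h.pos).filter_mono nhdsWithin_le_nhds
    · exact Filter.eventually_all.2 fun i =>
        (eventually_le_nhds (hδ i)).filter_mono nhdsWithin_le_nhds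
  obtain ⟨r', h0, hr', hle⟩ := hev.exists
  refine ⟨σ, r', h0, hr', fun i t ht => ?_⟩
  rw [hlin i t ⟨ht.1, ht.2.trans_le (hle i)⟩, h.zero]

theorem eventually_sum_eq (h : IsStarChart x r γ) {f : G → ℝ} (hf : IsRational f) :
    ∀ᶠ t in nhdsWithin (0:ℝ) (Ioi 0), ∑ i, (f (γ i t) - f x) = ordAt f x * t := by
  obtain ⟨σ, r', h0, hr', hlin⟩ := h.exists_linear hf
  have hord : ordAt f x = ∑ i, σ i := h.ordAt_eq fun i =>
    ⟨r', h0, fun t ht => by rw [hlin i t ht, h.zero]⟩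
  filter_upwards [Ioo_mem_nhdsGT h0] with t ht
  rw [hord]
  push_cast
  rw [Finset.sum_mul]
  refine Finset.sum_congr rfl fun i _ => ?_
  rw [hlin i t ⟨ht.1.le, ht.2⟩]
  ring

/-- A point in the interior of a branch has a chart with two branches, the first of which is
oriented outwards or inwards according to the sign `e`. -/
theorem interior_chart (h : IsStarChart x r γ) (i : Fin v) {t₀ e : ℝ} (ht₀ : 0 < t₀)
    (ht₀r : t₀ < r) (he : e = 1 ∨ e = -1) :
    IsStarChart (γ i t₀) (min t₀ (r - t₀))
      ![fun t => γ i (t₀ + e * t), fun t => γ i (t₀ - e * t)] := by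
  set r' := min t₀ (r - t₀) with hr'
  have h1 : r' ≤ t₀ := min_le_left _ _
  have h2 : r' ≤ r - t₀ := min_le_right _ _
  have hr0 : 0 < r' := lt_min ht₀ (by linarith)
  have hp : ∀ t ∈ Ico 0 r', t₀ + e * t ∈ Ico 0 r := fun t ht => by
    have := ht.1; have := ht.2
    rcases he with rfl | rfl <;> constructor <;> linarith
  have hm : ∀ t ∈ Ico 0 r', t₀ - e * t ∈ Ico 0 r := fun t ht => by
    have := ht.1; have := ht.2
    rcases he with rfl | rfl <;> constructor <;> linarith
  refine ⟨hr0, ?_, ?_, ?_, ?_⟩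
  · intro j
    fin_cases j <;> simp
  · intro j s hs t ht
    fin_cases j
    · simp only [Fin.zero_eta, Matrix.cons_val_zero]
      rw [h.dist_same i _ (hp s hs) _ (hp t ht)]
      rcases he with rfl | rfl
      · congr 1; ring
      · rw [abs_sub_comm]; congr 1; ring
    · simp only [Fin.mk_one, Matrix.cons_val_one, Matrix.cons_val_fin_one]
      rw [h.dist_same i _ (hm s hs) _ (hm t ht)]
      rcases he with rfl | rfl
      · rw [abs_sub_comm]; congr 1; ring
      · congr 1; ring
  · intro j k hjk s hs t ht
    have key : ∀ s ∈ Ico 0 r', ∀ t ∈ Ico 0 r',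
        dist (γ i (t₀ + e * s)) (γ i (t₀ - e * t)) = s + t := fun s hs t ht => by
      rw [h.dist_same i _ (hp s hs) _ (hm t ht)]
      have := hs.1; have := ht.1
      rcases he with rfl | rfl
      · rw [abs_of_nonneg] <;> linarith
      · rw [abs_of_nonpos] <;> linarith
    fin_cases j <;> fin_cases k
    · exact absurd rfl hjk
    · exact key s hs t ht
    · rw [dist_comm, add_comm]
      exact key t ht s hs
    · exact absurd rfl hjk
  · intro z hz
    have hz' : dist z x < r := by
      have := dist_triangle z (γ i t₀) x
      rw [h.dist_center i ⟨ht₀.le, ht₀r⟩] at this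
      linarith
    obtain ⟨j, t, ht, rfl⟩ := h.surj z hz'
    by_cases hij : j = i
    · subst hij
      rw [h.dist_same j t ht t₀ ⟨ht₀.le, ht₀r⟩] at hz
      rcases le_total t t₀ with hle | hle
      · rw [abs_of_nonpos (by linarith)] at hz
        rcases he with rfl | rfl
        · exact ⟨1, t₀ - t, ⟨by linarith, by linarith⟩, by simp⟩
        · exact ⟨0, t₀ - t, ⟨by linarith, by linarith⟩, by simp⟩
      · rw [abs_of_nonneg (by linarith)] at hz
        rcases he with rfl | rfl
        · exact ⟨0, t - t₀, ⟨by linarith, by linarith⟩, by simp⟩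
        · exact ⟨1, t - t₀, ⟨by linarith, by linarith⟩, by simp⟩
    · rw [h.dist_ne j i hij t ht t₀ ⟨ht₀.le, ht₀r⟩] at hz
      linarith [ht.1]

end IsStarChart

theorem IsRational.add {f f' : G → ℝ} (hf : IsRational f) (hf' : IsRational f') :
    IsRational (fun y => f y + f' y) := by
  refine ⟨hf.1.add hf'.1, fun x ε g hε hg => ?_⟩
  obtain ⟨s, hs⟩ := hf.2 x ε g hε hg
  obtain ⟨s', hs'⟩ := hf'.2 x ε g hε hg
  exact ⟨s + s', hs.add hs'⟩

theorem isRational_const (c : ℝ) : IsRational (fun _ : G => c) :=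
  ⟨continuous_const, fun _ _ _ _ _ => ⟨0, 1, one_pos, fun _ _ => by simp⟩⟩

theorem IsRational.max_const {f : G → ℝ} (hf : IsRational f) (b : ℝ) :
    IsRational (fun y => max (f y) b) := by
  refine ⟨hf.1.max continuous_const, fun x ε g hε hg => ?_⟩
  obtain ⟨s, δ, hδ, hs⟩ := hf.2 x ε g hε hg
  rcases lt_trichotomy (f (g 0)) b with hlt | heq | hgt
  · have hev : ∀ᶠ t : ℝ in nhds 0, f (g 0) + s * t < b :=
      (by fun_prop : Continuous fun t : ℝ => f (g 0) + s * t).continuousAt.eventually_lt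
        continuousAt_const (by simpa using hlt)
    obtain ⟨δ', hδ', hb⟩ := Metric.eventually_nhds_iff.1 hev
    refine ⟨0, min δ δ', lt_min hδ hδ', fun t ht => ?_⟩
    have h1 := hs t ⟨ht.1, ht.2.trans_le (min_le_left _ _)⟩
    have h2 := hb (y := t) (by
      rw [Real.dist_eq, sub_zero, abs_of_nonneg ht.1]; exact ht.2.trans_le (min_le_right _ _))
    beta_reduce
    rw [h1, max_eq_right h2.le, max_eq_right hlt.le]
    simp
  · rcases le_total 0 s with h0 | h0
    · refine ⟨s, δ, hδ, fun t ht => ?_⟩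
      have : 0 ≤ (s : ℝ) * t := mul_nonneg (by exact_mod_cast h0) ht.1
      beta_reduce
      rw [hs t ht, heq, max_self, max_eq_left (by linarith)]
    · refine ⟨0, δ, hδ, fun t ht => ?_⟩
      have : (s : ℝ) * t ≤ 0 := mul_nonpos_of_nonpos_of_nonneg (by exact_mod_cast h0) ht.1
      beta_reduce
      rw [hs t ht, heq, max_self, max_eq_right (by linarith)]
      simp
  · have hev : ∀ᶠ t : ℝ in nhds 0, b < f (g 0) + s * t :=
      continuousAt_const.eventually_lt
        (by fun_prop : Continuous fun t : ℝ => f (g 0) + s * t).continuousAt (by simpa using hgt)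
    obtain ⟨δ', hδ', hb⟩ := Metric.eventually_nhds_iff.1 hev
    refine ⟨s, min δ δ', lt_min hδ hδ', fun t ht => ?_⟩
    have h1 := hs t ⟨ht.1, ht.2.trans_le (min_le_left _ _)⟩
    have h2 := hb (y := t) (by
      rw [Real.dist_eq, sub_zero, abs_of_nonneg ht.1]; exact ht.2.trans_le (min_le_right _ _))
    beta_reduce
    rw [h1, max_eq_left h2.le, max_eq_left hgt.le]

theorem ordAt_add (hG : IsMetricGraph G) {f f' : G → ℝ} (hf : IsRational f)
    (hf' : IsRational f') (x : G) :
    ordAt (fun y => f y + f' y) x = ordAt f x + ordAt f' x := by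
  obtain ⟨v, r, γ, h⟩ := exists_isStarChart hG x
  obtain ⟨σ, hσ⟩ := h.exists_slopes hf
  obtain ⟨σ', hσ'⟩ := h.exists_slopes hf'
  rw [h.ordAt_eq hσ, h.ordAt_eq hσ', h.ordAt_eq fun i => (hσ i).add (hσ' i),
    Finset.sum_add_distrib]

theorem ordAt_const (hG : IsMetricGraph G) (c : ℝ) (x : G) : ordAt (fun _ : G => c) x = 0 := by
  obtain ⟨v, r, γ, h⟩ := exists_isStarChart hG x
  rw [h.ordAt_eq (σ := fun _ => 0) fun i => ⟨1, one_pos, fun _ _ => by simp⟩]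
  simp

/-- A function is rational if around every point it is linear with integer slopes along the
branches of some star chart. -/
theorem isRational_of_charts {F : G → ℝ} (hc : Continuous F)
    (h : ∀ y, ∃ (v : ℕ) (r : ℝ) (γ : Fin v → ℝ → G) (m : Fin v → ℤ), IsStarChart y r γ ∧
      ∀ i, ∀ t ∈ Ico (0:ℝ) r, F (γ i t) = F y + m i * t) : IsRational F := by
  refine ⟨hc, fun y ε g hε hg => ?_⟩
  obtain ⟨v, r, γ, m, hγ, hF⟩ := h y
  obtain ⟨i, δ, hδ, heq⟩ := hγ.exists_branch_eq hε hg
  exact ⟨m i, HasSlopeAlong.congr ⟨r, hγ.pos, fun t ht => by rw [hF i t ht, hγ.zero]⟩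
    ⟨δ, hδ, fun t ht => (heq t ht).symm⟩⟩

/-! ### Firing schedules on an interval -/

/-- Truncation of a real number to the interval `[0, L]`. -/
noncomputable def clamp (L p : ℝ) : ℝ := max 0 (min L p)

theorem clamp_nonneg (L p : ℝ) : 0 ≤ clamp L p := le_max_left _ _

theorem clamp_le {L : ℝ} (hL : 0 ≤ L) (p : ℝ) : clamp L p ≤ L := max_le hL (min_le_left _ _)

theorem clamp_of_nonpos {L p : ℝ} (hp : p ≤ 0) : clamp L p = 0 :=
  max_eq_left ((min_le_right _ _).trans hp)

theorem clamp_of_le {L p : ℝ} (hL : 0 ≤ L) (hp : L ≤ p) : clamp L p = L := by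
  rw [clamp, min_eq_left hp, max_eq_right hL]

theorem clamp_of_mem {L p : ℝ} (h0 : 0 ≤ p) (hp : p ≤ L) : clamp L p = p := by
  rw [clamp, min_eq_right hp, max_eq_right h0]

theorem clamp_of_nonneg {L p : ℝ} (hL : 0 ≤ L) (h0 : 0 ≤ p) : clamp L p = min L p :=
  max_eq_right (le_min hL h0)

theorem clamp_pos_iff {L p : ℝ} (hL : 0 < L) : 0 < clamp L p ↔ 0 < p := by
  rw [clamp, lt_max_iff, lt_min_iff]
  simp [hL]

theorem clamp_lt_iff {L p : ℝ} (hL : 0 < L) : clamp L p < L ↔ p < L := by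
  rw [clamp, max_lt_iff, min_lt_iff]
  simp [hL]

theorem clamp_add {L ε p : ℝ} (hL : 0 ≤ L) (hε : 0 ≤ ε) :
    clamp L p + clamp ε (p - L) = clamp (L + ε) p := by
  rcases le_total p 0 with h | h
  · rw [clamp_of_nonpos h, clamp_of_nonpos h, clamp_of_nonpos (by linarith), add_zero]
  rcases le_total p L with h' | h'
  · rw [clamp_of_mem h h', clamp_of_mem h (by linarith), clamp_of_nonpos (by linarith), add_zero]
  rcases le_total p (L + ε) with h'' | h''
  · rw [clamp_of_le hL h', clamp_of_mem h h'', clamp_of_mem (by linarith) (by linarith)]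
    ring
  · rw [clamp_of_le hL h', clamp_of_le (by linarith) h'', clamp_of_le hε (by linarith)]

theorem exists_clamp_linear {ε : ℝ} (hε : 0 < ε) (A : ℝ) {e : ℤ} (he : e = 0 ∨ e = 1 ∨ e = -1) :
    ∃ m : ℤ, (m = 0 ∨ m = 1 ∨ m = -1) ∧ ∃ δ > 0, ∀ t ∈ Ico (0:ℝ) δ,
      clamp ε (A + e * t) = clamp ε A + m * t := by
  rcases he with rfl | rfl | rfl
  · exact ⟨0, by simp, 1, one_pos, fun t _ => by simp⟩
  · rcases lt_or_ge A 0 with h | h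
    · refine ⟨0, by simp, -A, by linarith, fun t ht => ?_⟩
      have := ht.1; have := ht.2
      rw [clamp_of_nonpos (by push_cast; linarith), clamp_of_nonpos h.le]; simp
    rcases lt_or_ge A ε with h' | h'
    · refine ⟨1, by simp, ε - A, by linarith, fun t ht => ?_⟩
      have := ht.1; have := ht.2
      rw [clamp_of_mem (by push_cast; linarith) (by push_cast; linarith), clamp_of_mem h h'.le]
    · refine ⟨0, by simp, 1, one_pos, fun t ht => ?_⟩
      have := ht.1; have := ht.2
      rw [clamp_of_le hε.le (by push_cast; linarith), clamp_of_le hε.le h']; simp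
  · rcases le_or_gt A 0 with h | h
    · refine ⟨0, by simp, 1, one_pos, fun t ht => ?_⟩
      have := ht.1; have := ht.2
      rw [clamp_of_nonpos (by push_cast; linarith), clamp_of_nonpos h]; simp
    rcases le_or_gt A ε with h' | h'
    · refine ⟨-1, by simp, A, h, fun t ht => ?_⟩
      have := ht.1; have := ht.2
      rw [clamp_of_mem (by push_cast; linarith) (by push_cast; linarith), clamp_of_mem h.le h']
    · refine ⟨0, by simp, A - ε, by linarith, fun t ht => ?_⟩
      have := ht.1; have := ht.2
      rw [clamp_of_le hε.le (by push_cast; linarith), clamp_of_le hε.le h'.le]; simp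

/-- The displacement at position `p` of a branch carrying `s` chips after `k` firings of
length `ε`, where the chips are moved one after the other. -/
noncomputable def fired (ε : ℝ) (s k : ℕ) (p : ℝ) : ℝ :=
  ∑ j ∈ Finset.range k, clamp ε (p - ε * (j / s : ℕ))

section fired

variable {ε : ℝ} {s : ℕ}

theorem fired_eq_aux (hε : 0 < ε) (hs : 0 < s) (p : ℝ) (Q : ℕ) {R : ℕ} (hR : R ≤ s)
    (h : fired ε s (s * Q) p = s * clamp (Q * ε) p) :
    fired ε s (s * Q + R) p = (s - R) * clamp (Q * ε) p + R * clamp ((Q + 1) * ε) p := by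
  have h1 : ∑ i ∈ Finset.range R, clamp ε (p - ε * ((s * Q + i) / s : ℕ))
      = R * clamp ε (p - Q * ε) := by
    rw [Finset.sum_congr rfl (g := fun _ => clamp ε (p - Q * ε)), Finset.sum_const,
      Finset.card_range, nsmul_eq_mul]
    intro i hi
    have hi' : i < s := (Finset.mem_range.1 hi).trans_le hR
    rw [Nat.mul_add_div hs, Nat.div_eq_of_lt hi', add_zero, mul_comm ε]
  have h2 : clamp ((Q + 1) * ε) p = clamp (Q * ε) p + clamp ε (p - Q * ε) := by
    rw [clamp_add (by positivity) hε.le]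
    congr 1
    ring
  have h3 : fired ε s (s * Q + R) p = fired ε s (s * Q) p
      + ∑ i ∈ Finset.range R, clamp ε (p - ε * ((s * Q + i) / s : ℕ)) := by
    rw [fired, Finset.sum_range_add, fired]
  rw [h3, h, h1, h2]
  ring

theorem fired_mul (hε : 0 < ε) (hs : 0 < s) (p : ℝ) (Q : ℕ) :
    fired ε s (s * Q) p = s * clamp (Q * ε) p := by
  induction Q with
  | zero =>
    have : clamp (((0:ℕ):ℝ) * ε) p = 0 :=
      le_antisymm ((clamp_le (by simp) p).trans (by simp)) (clamp_nonneg _ _)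
    rw [this, Nat.mul_zero, fired]
    simp
  | succ Q ih =>
    rw [Nat.mul_succ, fired_eq_aux hε hs p Q le_rfl ih]
    push_cast
    ring

theorem fired_eq (hε : 0 < ε) (hs : 0 < s) (p : ℝ) (k : ℕ) :
    fired ε s k p = (s - (k % s : ℕ)) * clamp ((k / s : ℕ) * ε) p
      + (k % s : ℕ) * clamp (((k / s : ℕ) + 1) * ε) p := by
  conv_lhs => rw [← Nat.div_add_mod k s]
  exact fired_eq_aux hε hs p _ (Nat.mod_lt k hs).le (fired_mul hε hs p _)

theorem fired_of_nonpos {p : ℝ} (hε : 0 < ε) (hp : p ≤ 0) (k : ℕ) : fired ε s k p = 0 :=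
  Finset.sum_eq_zero fun j _ => clamp_of_nonpos <| by
    have : 0 ≤ ε * (j / s : ℕ) := by positivity
    linarith

theorem fired_le (hε : 0 < ε) (k : ℕ) (p : ℝ) : fired ε s k p ≤ k * ε := by
  have := Finset.sum_le_card_nsmul (Finset.range k)
    (fun j => clamp ε (p - ε * (j / s : ℕ))) ε fun j _ => clamp_le hε.le _
  rwa [Finset.card_range, nsmul_eq_mul] at this

theorem clamp_fired_of_le {M j : ℕ} {p : ℝ} (hε : 0 < ε) (hs : 0 < s) (hsM : s ∣ M) (hj : j < M)
    (hp : M * ε ≤ s * p) : clamp ε (p - ε * (j / s : ℕ)) = ε := by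
  refine clamp_of_le hε.le ?_
  obtain ⟨N, rfl⟩ := hsM
  have h1 : j / s + 1 ≤ N := Nat.div_lt_of_lt_mul hj
  have h2 : ((j / s : ℕ) : ℝ) + 1 ≤ N := by exact_mod_cast h1
  push_cast at hp
  rw [mul_assoc] at hp
  have h3 := le_of_mul_le_mul_left hp (by exact_mod_cast hs)
  have := mul_le_mul_of_nonneg_right h2 hε.le
  linarith

theorem fired_of_le {M k : ℕ} {p : ℝ} (hε : 0 < ε) (hs : 0 < s) (hsM : s ∣ M) (hk : k ≤ M)
    (hp : M * ε ≤ s * p) : fired ε s k p = k * ε := by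
  rw [fired, Finset.sum_congr rfl (g := fun _ => ε), Finset.sum_const, Finset.card_range,
    nsmul_eq_mul]
  exact fun j hj => clamp_fired_of_le hε hs hsM ((Finset.mem_range.1 hj).trans_le hk) hp

theorem fired_eq_of_nonneg (hε : 0 < ε) (hs : 0 < s) {p : ℝ} (hp : 0 ≤ p) (k : ℕ) :
    fired ε s k p = (s - (k % s : ℕ)) * min ((k / s : ℕ) * ε) p
      + (k % s : ℕ) * min (((k / s : ℕ) + 1) * ε) p := by
  rw [fired_eq hε hs, clamp_of_nonneg (by positivity) hp, clamp_of_nonneg (by positivity) hp]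

theorem sub_mod_nonneg (hs : 0 < s) (k : ℕ) : (0:ℝ) ≤ s - (k % s : ℕ) := by
  have : ((k % s : ℕ) : ℝ) ≤ s := by exact_mod_cast (Nat.mod_lt k hs).le
  linarith

theorem fired_le_mul (hε : 0 < ε) (hs : 0 < s) {p : ℝ} (hp : 0 ≤ p) (k : ℕ) :
    fired ε s k p ≤ s * p := by
  rw [fired_eq_of_nonneg hε hs hp]
  have h1 := mul_le_mul_of_nonneg_left (min_le_right (((k / s : ℕ) : ℝ) * ε) p) (sub_mod_nonneg hs k)
  have h2 := mul_le_mul_of_nonneg_left (min_le_right ((((k / s : ℕ) : ℝ) + 1) * ε) p)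
    (Nat.cast_nonneg (α := ℝ) (k % s))
  linarith

theorem fired_total {M : ℕ} (hε : 0 < ε) (hs : 0 < s) (hsM : s ∣ M) {p : ℝ} (hp : 0 ≤ p)
    (hpM : s * p ≤ M * ε) : fired ε s M p = s * p := by
  obtain ⟨N, rfl⟩ := hsM
  push_cast at hpM
  rw [mul_assoc] at hpM
  rw [fired_mul hε hs, clamp_of_mem hp (le_of_mul_le_mul_left hpM (by exact_mod_cast hs))]

theorem fired_midpoint (hε : 0 < ε) (hs : 0 < s) {p t : ℝ} (ht : 0 ≤ t) (hp : 0 ≤ p - t) (k : ℕ) :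
    fired ε s k (p - t) + fired ε s k (p + t) ≤ 2 * fired ε s k p := by
  have hmin : ∀ L : ℝ, min L (p - t) + min L (p + t) ≤ 2 * min L p := fun L => by
    rcases le_total L p with h | h
    · rw [min_eq_left h]
      linarith [min_le_left L (p - t), min_le_left L (p + t)]
    · rw [min_eq_right h]
      linarith [min_le_right L (p - t), min_le_right L (p + t)]
  rw [fired_eq_of_nonneg hε hs hp, fired_eq_of_nonneg hε hs (by linarith : 0 ≤ p),
    fired_eq_of_nonneg hε hs (by linarith : 0 ≤ p + t)]
  have h1 := mul_le_mul_of_nonneg_left (hmin (((k / s : ℕ) : ℝ) * ε)) (sub_mod_nonneg hs k)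
  have h2 := mul_le_mul_of_nonneg_left (hmin ((((k / s : ℕ) : ℝ) + 1) * ε))
    (Nat.cast_nonneg (α := ℝ) (k % s))
  linarith

end fired

/-! ### Local scale of a function -/

open scoped Classical in
/-- The absolute value of the slope of `f` at a point around which `f` is linear and
non-constant, and `1` at all other points. -/
noncomputable def scale (f : G → ℝ) (y : G) : ℕ :=
  if h : ∃ n : ℕ, 0 < n ∧ ∀ᶠ z in nhds y, |f z - f y| = n * dist z y then h.choose else 1

theorem IsStarChart.natAbs_eq_of_eventually {y : G} {v : ℕ} {r : ℝ} {γ : Fin v → ℝ → G}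
    (h : IsStarChart y r γ) {f : G → ℝ} {i : Fin v} {σ : ℤ}
    (hf : ∀ t ∈ Ico (0:ℝ) r, f (γ i t) = f y + σ * t) {n : ℕ}
    (hn : ∀ᶠ z in nhds y, |f z - f y| = n * dist z y) : n = σ.natAbs := by
  obtain ⟨δ, hδ, hδn⟩ := Metric.eventually_nhds_iff.1 hn
  have h0 : 0 < min δ r := lt_min hδ h.pos
  have htr : min δ r / 2 ∈ Ico 0 r := ⟨by linarith, by linarith [min_le_right δ r]⟩
  have h1 := hδn (y := γ i (min δ r / 2)) (by
    rw [h.dist_center i htr]; linarith [min_le_left δ r])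
  rw [h.dist_center i htr, hf _ htr, add_sub_cancel_left, abs_mul, abs_of_nonneg htr.1] at h1
  have h2 := mul_right_cancel₀ (by positivity : min δ r / 2 ≠ 0) h1
  rw [← Int.cast_abs, Int.abs_eq_natAbs, Int.cast_natCast] at h2
  exact_mod_cast h2.symm

theorem IsStarChart.scale_eq {y : G} {v : ℕ} {r : ℝ} {γ : Fin v → ℝ → G}
    (h : IsStarChart y r γ) {f : G → ℝ} {σ : Fin v → ℤ}
    (hf : ∀ i, ∀ t ∈ Ico (0:ℝ) r, f (γ i t) = f y + σ i * t) {n : ℕ} (hn : 0 < n)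
    (hσ : ∀ i, (σ i).natAbs = n) : scale f y = n := by
  have hev : ∀ᶠ z in nhds y, |f z - f y| = n * dist z y := by
    filter_upwards [Metric.ball_mem_nhds y h.pos] with z hz
    obtain ⟨i, t, ht, rfl⟩ := h.surj z hz
    rw [h.dist_center i ht, hf i t ht, add_sub_cancel_left, abs_mul, abs_of_nonneg ht.1,
      ← hσ i, ← Int.cast_abs, Int.abs_eq_natAbs, Int.cast_natCast]
  have hex : ∃ n : ℕ, 0 < n ∧ ∀ᶠ z in nhds y, |f z - f y| = n * dist z y := ⟨n, hn, hev⟩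
  rw [scale, dif_pos hex]
  obtain ⟨i⟩ := h.nonempty
  rw [h.natAbs_eq_of_eventually (hf i) hex.choose_spec.2, hσ]

/-- The chart at an interior point of a branch on which `f` is linear. -/
theorem IsStarChart.interior_linear {x : G} {v : ℕ} {r : ℝ} {γ : Fin v → ℝ → G}
    (h : IsStarChart x r γ) {f : G → ℝ} {i : Fin v} {σ : ℤ}
    (hf : ∀ t ∈ Ico (0:ℝ) r, f (γ i t) = f x + σ * t) {t₀ : ℝ} (h0 : 0 < t₀) (hr : t₀ < r)
    {e : ℤ} (he : e = 1 ∨ e = -1) :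
    ∃ (r' : ℝ) (γ' : Fin 2 → ℝ → G), IsStarChart (γ i t₀) r' γ' ∧
      ∀ j, ∀ t ∈ Ico (0:ℝ) r', f (γ' j t) = f (γ i t₀) + (![σ * e, -(σ * e)] j : ℤ) * t := by
  have he' : (e : ℝ) = 1 ∨ (e : ℝ) = -1 := by exact_mod_cast he
  refine ⟨_, _, h.interior_chart i h0 hr he', ?_⟩
  intro j t ht
  have h1 := ht.1
  have h2 := ht.2.trans_le (min_le_left _ _)
  have h3 := ht.2.trans_le (min_le_right _ _)
  have hm : t₀ + e * t ∈ Ico 0 r ∧ t₀ - e * t ∈ Ico 0 r := by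
    rcases he' with h | h <;> rw [h] <;> refine ⟨⟨?_, ?_⟩, ⟨?_, ?_⟩⟩ <;> linarith
  rw [hf t₀ ⟨h0.le, hr⟩]
  fin_cases j
  · simp only [Fin.zero_eta, Matrix.cons_val_zero]
    rw [hf _ hm.1]; push_cast; ring
  · simp only [Fin.mk_one, Matrix.cons_val_one, Matrix.cons_val_fin_one]
    rw [hf _ hm.2]; push_cast; ring

theorem IsStarChart.scale_branch {x : G} {v : ℕ} {r : ℝ} {γ : Fin v → ℝ → G}
    (h : IsStarChart x r γ) {f : G → ℝ} {i : Fin v} {σ : ℤ}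
    (hf : ∀ t ∈ Ico (0:ℝ) r, f (γ i t) = f x + σ * t) (hσ : σ ≠ 0) {t : ℝ} (h0 : 0 < t)
    (hr : t < r) : scale f (γ i t) = σ.natAbs := by
  obtain ⟨r', γ', hc, hlin⟩ := h.interior_linear hf h0 hr (e := 1) (Or.inl rfl)
  refine hc.scale_eq hlin (Int.natAbs_pos.2 hσ) fun j => ?_
  fin_cases j <;> simp

/-! ### Adapted covers by stars -/

/-- A set `C` of critical values of `f`, a common multiple `M` of the nonzero slopes of `f`, and
a length `ρ` such that noncritical points lie on linear branches extending them by `ρ`. -/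
structure Adapted (f : G → ℝ) (C : Set ℝ) (M : ℕ) (ρ : ℝ) : Prop where
  M_pos : 0 < M
  ρ_pos : 0 < ρ
  chart : ∀ y, ∃ (v : ℕ) (r : ℝ) (γ : Fin v → ℝ → G) (σ : Fin v → ℤ), IsStarChart y r γ ∧
    (∀ i, ∀ t ∈ Ico (0:ℝ) r, f (γ i t) = f y + σ i * t) ∧ ∀ i, σ i ≠ 0 → (σ i).natAbs ∣ M
  edge : ∀ y, f y ∉ C → ∃ (x : G) (v : ℕ) (r : ℝ) (γ : Fin v → ℝ → G) (i : Fin v) (t₀ : ℝ)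
    (σ : ℤ), IsStarChart x r γ ∧ γ i t₀ = y ∧ 0 < t₀ ∧ t₀ + ρ ≤ r ∧ σ ≠ 0 ∧ σ.natAbs ∣ M ∧
      f x ∈ C ∧ ∀ t ∈ Ico (0:ℝ) r, f (γ i t) = f x + σ * t

theorem exists_adapted (hG : IsMetricGraph G) {f : G → ℝ} (hf : IsRational f) :
    ∃ (C : Set ℝ) (M : ℕ) (ρ : ℝ), C.Finite ∧ Adapted f C M ρ := by
  have := hG.1
  have hx : ∀ x : G, ∃ (v : ℕ) (r : ℝ) (γ : Fin v → ℝ → G) (σ : Fin v → ℤ), IsStarChart x r γ ∧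
      ∀ i, ∀ t ∈ Ico (0:ℝ) r, f (γ i t) = f x + σ i * t := fun x => by
    obtain ⟨v, r, γ, h⟩ := exists_isStarChart hG x
    obtain ⟨σ, r', h0, hr', hlin⟩ := h.exists_linear hf
    exact ⟨v, r', γ, σ, h.mono h0 hr', hlin⟩
  choose v r γ σ hγ hlin using hx
  obtain ⟨X, hX⟩ := isCompact_univ.elim_finite_subcover (fun x : G => Metric.ball x (r x / 2))
    (fun x => Metric.isOpen_ball)
    (fun x _ => mem_iUnion.2 ⟨x, Metric.mem_ball_self (half_pos (hγ x).pos)⟩)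
  obtain ⟨ρ, hρ, hρX⟩ : ∃ ρ : ℝ, 0 < ρ ∧ ∀ x ∈ X, ρ ≤ r x / 2 := by
    clear hX
    induction X using Finset.cons_induction with
    | empty => exact ⟨1, one_pos, by simp⟩
    | cons a s ha ih =>
      obtain ⟨ρ, hρ, h⟩ := ih
      refine ⟨min ρ (r a / 2), lt_min hρ (half_pos (hγ a).pos), fun x hx => ?_⟩
      rcases Finset.mem_cons.1 hx with rfl | hx
      · exact min_le_right _ _
      · exact (min_le_left _ _).trans (h x hx)
  let m : ℤ → ℕ := fun s => if s = 0 then 1 else s.natAbs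
  have hm : ∀ s, 0 < m s := fun s => by
    by_cases h : s = 0 <;> simp [m, h]
  have hM : ∀ x ∈ X, ∀ i, σ x i ≠ 0 → (σ x i).natAbs ∣ ∏ x ∈ X, ∏ i, m (σ x i) := by
    intro x hx i hi
    have h1 : (σ x i).natAbs = m (σ x i) := by simp [m, hi]
    rw [h1]
    exact (Finset.dvd_prod_of_mem (fun i => m (σ x i)) (Finset.mem_univ i)).trans
      (Finset.dvd_prod_of_mem (fun x => ∏ i, m (σ x i)) hx)
  have hcov : ∀ y, ∃ x ∈ X, ∃ i, ∃ t ∈ Ico 0 (r x), t < r x / 2 ∧ γ x i t = y := fun y => by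
    obtain ⟨x, hxX, hy⟩ := mem_iUnion₂.1 (hX (mem_univ y))
    have hy' := Metric.mem_ball.1 hy
    obtain ⟨i, t, ht, rfl⟩ := (hγ x).surj y (by linarith [(hγ x).pos])
    rw [(hγ x).dist_center i ht] at hy'
    exact ⟨x, hxX, i, t, ht, hy', rfl⟩
  refine ⟨f '' X, ∏ x ∈ X, ∏ i, m (σ x i), ρ, X.finite_toSet.image f,
    Finset.prod_pos fun x _ => Finset.prod_pos fun i _ => hm (σ x i), hρ, fun y => ?_,
    fun y hy => ?_⟩
  · obtain ⟨x, hxX, i, t, ht, -, rfl⟩ := hcov y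
    rcases eq_or_lt_of_le ht.1 with rfl | h0
    · rw [(hγ x).zero]
      exact ⟨v x, r x, γ x, σ x, hγ x, hlin x, hM x hxX⟩
    · obtain ⟨r', γ', hc, hl⟩ := (hγ x).interior_linear (hlin x i) h0 ht.2 (e := 1) (Or.inl rfl)
      refine ⟨2, r', γ', _, hc, hl, fun j hj => ?_⟩
      fin_cases j <;> simpa using hM x hxX i (by simpa using hj)
  · obtain ⟨x, hxX, i, t, ht, ht', rfl⟩ := hcov y
    have hne : f (γ x i t) ≠ f x := fun h => hy (h ▸ mem_image_of_mem f hxX)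
    have hσ : σ x i ≠ 0 := fun h => hne (by rw [hlin x i t ht, h]; simp)
    refine ⟨x, v x, r x, γ x, i, t, σ x i, hγ x, rfl, lt_of_le_of_ne ht.1 ?_,
      by linarith [hρX x hxX], hσ, hM x hxX i hσ, mem_image_of_mem f hxX, hlin x i⟩
    rintro rfl
    exact hne (by rw [(hγ x).zero])

namespace Adapted

variable {f : G → ℝ} {C : Set ℝ} {M : ℕ} {ρ : ℝ}

theorem mul (h : Adapted f C M ρ) {N : ℕ} (hN : 0 < N) : Adapted f C (N * M) ρ where
  M_pos := Nat.mul_pos hN h.M_pos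
  ρ_pos := h.ρ_pos
  chart y := by
    obtain ⟨v, r, γ, σ, hc, hl, hd⟩ := h.chart y
    exact ⟨v, r, γ, σ, hc, hl, fun i hi => (hd i hi).mul_left N⟩
  edge y hy := by
    obtain ⟨x, v, r, γ, i, t₀, σ, hc, hy, h0, hr, hσ, hd, hC⟩ := h.edge y hy
    exact ⟨x, v, r, γ, i, t₀, σ, hc, hy, h0, hr, hσ, hd.mul_left N, hC⟩

theorem regular (h : Adapted f C M ρ) {y : G} (hy : f y ∉ C) :
    ∃ (r : ℝ) (γ : Fin 2 → ℝ → G) (n : ℕ), IsStarChart y r γ ∧ 0 < n ∧ n ∣ M ∧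
      scale f y = n ∧ ∀ t ∈ Ico (0:ℝ) r, f (γ 0 t) = f y + n * t ∧ f (γ 1 t) = f y - n * t ∧
        ∀ i, scale f (γ i t) = n := by
  obtain ⟨x, v, r, γ, i, t₀, σ, hc, rfl, h0, hr, hσ, hd, -, hl⟩ := h.edge y hy
  have hr' : t₀ < r := by linarith [h.ρ_pos]
  obtain ⟨n, hn⟩ : ∃ n, σ.natAbs = n := ⟨_, rfl⟩
  have hn0 : 0 < n := hn ▸ Int.natAbs_pos.2 hσ
  obtain ⟨e, he, heσ⟩ : ∃ e : ℤ, (e = 1 ∨ e = -1) ∧ σ * e = n := by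
    rcases lt_or_gt_of_ne hσ with h | h
    · exact ⟨-1, Or.inr rfl, by omega⟩
    · exact ⟨1, Or.inl rfl, by omega⟩
  obtain ⟨r', γ', hc', hl'⟩ := hc.interior_linear hl h0 hr' he
  have hy := hc.scale_branch hl hσ h0 hr'
  rw [hn] at hd hy
  refine ⟨r', γ', n, hc', hn0, hd, hy, fun t ht => ⟨?_, ?_, fun j => ?_⟩⟩
  · rw [hl' 0 t ht, Matrix.cons_val_zero, heσ]; simp
  · rw [hl' 1 t ht, Matrix.cons_val_one, Matrix.cons_val_fin_one, heσ]; push_cast; ring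
  · rcases eq_or_lt_of_le ht.1 with rfl | h0'
    · rw [hc'.zero, hy]
    · rw [hc'.scale_branch (hl' j) ?_ h0' ht.2]
      · fin_cases j <;> simp [heσ]
      · fin_cases j <;> simpa [heσ] using hn0.ne'

theorem scale_pos_dvd (h : Adapted f C M ρ) (y : G) : 0 < scale f y ∧ scale f y ∣ M := by
  rw [scale]
  split_ifs with hex
  · obtain ⟨v, r, γ, σ, hc, hl, hd⟩ := h.chart y
    obtain ⟨i⟩ := hc.nonempty
    have := hc.natAbs_eq_of_eventually (hl i) hex.choose_spec.2
    refine ⟨hex.choose_spec.1, ?_⟩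
    rw [this]
    refine hd i fun h0 => ?_
    have := hex.choose_spec.1
    simp_all
  · simp

end Adapted

/-! ### Recognizing chip firing moves -/

/-- Around every point, `F` is linear with slopes in `{-1, 0, 1}`. -/
def HasUnitSlopes (F : G → ℝ) : Prop :=
  ∀ y, ∃ (v : ℕ) (r : ℝ) (γ : Fin v → ℝ → G) (m : Fin v → ℤ), IsStarChart y r γ ∧
    (∀ i, m i = 0 ∨ m i = 1 ∨ m i = -1) ∧ ∀ i, ∀ t ∈ Ico (0:ℝ) r, F (γ i t) = F y + m i * t

theorem hasUnitSlopes_of_clamp {F : G → ℝ} {ε : ℝ} (hε : 0 < ε)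
    (h : ∀ y, ∃ (v : ℕ) (r : ℝ) (γ : Fin v → ℝ → G), IsStarChart y r γ ∧
      ∀ i, ∃ (A : ℝ) (e : ℤ), (e = 0 ∨ e = 1 ∨ e = -1) ∧
        ∀ t ∈ Ico (0:ℝ) r, F (γ i t) = -clamp ε (A + e * t)) : HasUnitSlopes F := by
  intro y
  obtain ⟨v, r, γ, hγ, h⟩ := h y
  choose A e he hF using h
  choose m hm δ hδ hlin using fun i => exists_clamp_linear hε (A i) (he i)
  obtain ⟨δ', hδ', hle⟩ : ∃ δ', 0 < δ' ∧ ∀ i, δ' ≤ δ i := by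
    have := hγ.nonempty
    obtain ⟨i, hi⟩ := Finite.exists_min δ
    exact ⟨δ i, hδ i, hi⟩
  refine ⟨v, min r δ', γ, fun i => -m i, hγ.mono (lt_min hγ.pos hδ') (min_le_left _ _),
    fun i => ?_, fun i t ht => ?_⟩
  · have := hm i
    dsimp only
    omega
  · have h0 := hF i 0 hγ.zero_mem
    rw [hγ.zero, mul_zero, add_zero] at h0
    rw [hF i t ⟨ht.1, ht.2.trans_le (min_le_left _ _)⟩,
      hlin i t ⟨ht.1, ht.2.trans_le ((min_le_right _ _).trans (hle i))⟩, h0]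
    push_cast
    ring

namespace HasUnitSlopes

variable {F : G → ℝ}

theorem eventually (h : HasUnitSlopes F) (y : G) : ∀ᶠ z in nhds y, |F z - F y| ≤ dist z y := by
  obtain ⟨v, r, γ, m, hγ, hm, hF⟩ := h y
  filter_upwards [Metric.ball_mem_nhds y hγ.pos] with z hz
  obtain ⟨i, t, ht, rfl⟩ := hγ.surj z hz
  rw [hF i t ht, hγ.dist_center i ht, add_sub_cancel_left]
  have := ht.1
  rcases hm i with h | h | h <;> rw [h] <;> simp [abs_of_nonneg this, this]

theorem abs_sub_le (h : HasUnitSlopes F) (hG : IsMetricGraph G) (p q : G) :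
    |F p - F q| ≤ dist p q :=
  abs_sub_le_dist_of_eventually hG.2.1 h.eventually p q

theorem continuous (h : HasUnitSlopes F) (hG : IsMetricGraph G) : Continuous F :=
  (LipschitzWith.of_dist_le_mul (K := 1) fun p q => by
    rw [Real.dist_eq, NNReal.coe_one, one_mul]; exact h.abs_sub_le hG p q).continuous

theorem isRational (h : HasUnitSlopes F) (hG : IsMetricGraph G) : IsRational F :=
  isRational_of_charts (h.continuous hG) fun y =>
    let ⟨v, r, γ, m, hγ, _, hF⟩ := h y
    ⟨v, r, γ, m, hγ, hF⟩

end HasUnitSlopes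

theorem finite_compsOf [CompactSpace G] {Z : Set G}
    (h : ∀ y, ∃ N ∈ nhds y, IsPreconnected (Z ∩ N)) : (compsOf Z).Finite := by
  choose N hN hc using h
  obtain ⟨X, hX⟩ := isCompact_univ.elim_nhds_subcover N fun y _ => hN y
  classical
  refine ((X.finite_toSet).image fun x =>
    if hx : (Z ∩ N x).Nonempty then connectedComponentIn Z hx.some else ∅).subset ?_
  rintro _ ⟨y, hy, rfl⟩
  obtain ⟨x, hxX, hyx⟩ := mem_iUnion₂.1 (hX.2 (mem_univ y))
  have hx : (Z ∩ N x).Nonempty := ⟨y, hy, hyx⟩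
  refine ⟨x, hxX, ?_⟩
  simp only [dif_pos hx]
  exact (connectedComponentIn_eq ((hc x).subset_connectedComponentIn hx.some_mem
    inter_subset_left ⟨hy, hyx⟩))

theorem HasUnitSlopes.finite_compsOf {F : G → ℝ} (h : HasUnitSlopes F) (hG : IsMetricGraph G)
    (c : ℝ) : (compsOf {y | F y = c}).Finite := by
  have := hG.1
  refine TropGraph.finite_compsOf fun y => ?_
  by_cases hy : F y = c
  · obtain ⟨v, r, γ, m, hγ, hm, hF⟩ := h y
    refine ⟨_, Metric.ball_mem_nhds y hγ.pos, isPreconnected_of_forall y fun z hz => ?_⟩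
    obtain ⟨i, t, ht, rfl⟩ := hγ.surj z hz.2
    have hyb : y ∈ {y | F y = c} ∩ Metric.ball y r := ⟨hy, Metric.mem_ball_self hγ.pos⟩
    by_cases hi : m i = 0
    · refine ⟨γ i '' Ico 0 r, ?_, ⟨0, hγ.zero_mem, hγ.zero i⟩, ⟨t, ht, rfl⟩,
        isPreconnected_Ico.image _ (hγ.continuousOn i)⟩
      rintro _ ⟨s, hs, rfl⟩
      refine ⟨?_, ?_⟩
      · simp only [mem_ofPred_eq]
        rw [hF i s hs, hi, hy]; simp
      · rw [Metric.mem_ball, hγ.dist_center i hs]; exact hs.2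
    · have h1 : F (γ i t) = c := hz.1
      rw [hF i t ht, hy] at h1
      have h2 : (m i : ℝ) ≠ 0 := by exact_mod_cast hi
      have h3 : t = 0 := by
        have : (m i : ℝ) * t = 0 := by linarith
        exact (mul_eq_zero.1 this).resolve_left h2
      refine ⟨{y}, by simpa using hyb, rfl, ?_, isPreconnected_singleton⟩
      rw [h3, hγ.zero]; rfl
  · refine ⟨_, (isOpen_ne_fun (h.continuous hG) continuous_const).mem_nhds hy, ?_⟩
    convert isPreconnected_empty
    ext z
    simp only [mem_inter_iff, mem_ofPred_eq, mem_empty_iff_false, iff_false]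
    tauto

theorem eq_CF [CompactSpace G] {F : G → ℝ} {ε : ℝ} (hr : ∀ y, -ε ≤ F y ∧ F y ≤ 0)
    (hL : ∀ p q, |F p - F q| ≤ dist p q) (hc : Continuous F) (hne : {y | F y = 0}.Nonempty)
    (hasc : ∀ y, -ε < F y → F y < 0 → ∃ z, z ≠ y ∧ F z - F y = dist z y) :
    F = CF {y | F y = 0} ε := by
  have hlow : ∀ y, -F y ≤ Metric.infDist y {y | F y = 0} := fun y =>
    (Metric.le_infDist hne).2 fun {z} hz => by
      have h1 := (abs_le.1 (hL y z)).1
      rw [hz] at h1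
      linarith
  funext y
  rw [CF]
  rcases eq_or_lt_of_le (hr y).1 with h | h
  · rw [min_eq_right, h]
    linarith [hlow y]
  · suffices hup : Metric.infDist y {y | F y = 0} = -F y by
      rw [hup, min_eq_left (by linarith), neg_neg]
    refine le_antisymm ?_ (hlow y)
    have hK : IsCompact {z | dist y z ≤ F z - F y} :=
      (isClosed_le (by fun_prop) (by fun_prop)).isCompact
    obtain ⟨z, hz, hmax⟩ := hK.exists_isMaxOn ⟨y, by simp⟩ hc.continuousOn
    simp only [mem_ofPred_eq] at hz
    have hz0 : F z = 0 := by
      by_contra hne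
      have hd := dist_nonneg (x := y) (y := z)
      obtain ⟨w, hw, hwz⟩ := hasc z (by linarith) (lt_of_le_of_ne (hr z).2 hne)
      have h1 : F w ≤ F z := hmax (by
        have := dist_triangle y z w
        rw [dist_comm z w] at this
        simp only [mem_ofPred_eq]
        linarith)
      have := dist_pos.2 hw
      linarith
    refine (Metric.infDist_le_dist_of_mem (s := {y | F y = 0}) hz0).trans ?_
    linarith

/-- The branches through the points where `-ε < F < 0` are unit slope ramps. -/
def HasRamps (F : G → ℝ) (ε : ℝ) : Prop :=
  ∀ y, -ε < F y → F y < 0 → ∃ (x : G) (v : ℕ) (r : ℝ) (γ : Fin v → ℝ → G) (i : Fin v)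
    (t₀ A : ℝ) (e : ℤ), IsStarChart x r γ ∧ γ i t₀ = y ∧ 0 < t₀ ∧ t₀ + ε < r ∧
      (e = 1 ∨ e = -1) ∧ (F x = 0 ∨ F x = -ε) ∧
      ∀ t ∈ Ico (0:ℝ) r, F (γ i t) = -clamp ε (A + e * t)

theorem HasRamps.ascent {F : G → ℝ} {ε : ℝ} (hε : 0 < ε) (h : HasRamps F ε) {y : G}
    (h1 : -ε < F y) (h2 : F y < 0) : ∃ z, z ≠ y ∧ F z - F y = dist z y := by
  obtain ⟨x, v, r, γ, i, t₀, A, e, hγ, rfl, h0, hr, he, -, hF⟩ := h y h1 h2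
  have ht₀ : t₀ ∈ Ico 0 r := ⟨h0.le, by linarith⟩
  have hy := hF t₀ ht₀
  rw [hy, neg_lt_neg_iff, clamp_lt_iff hε] at h1
  rw [hy, neg_lt_zero, clamp_pos_iff hε] at h2
  obtain ⟨δ, hδ, hδt, hδA⟩ : ∃ δ, 0 < δ ∧ δ < t₀ ∧ δ < A + e * t₀ := by
    obtain ⟨δ, hδ, h⟩ := exists_between (lt_min h0 h2)
    exact ⟨δ, hδ, h.trans_le (min_le_left _ _), h.trans_le (min_le_right _ _)⟩
  have he' : (e : ℝ) = 1 ∨ (e : ℝ) = -1 := by exact_mod_cast he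
  have hee : (e : ℝ) * e = 1 := by rcases he' with h | h <;> rw [h] <;> norm_num
  have hd : A + e * (t₀ - e * δ) = A + e * t₀ - δ := by linear_combination (-δ) * hee
  have ht : t₀ - e * δ ∈ Ico 0 r := by
    rcases he' with h | h <;> rw [h] <;> rw [h] at h1 hδA <;> constructor <;> linarith
  have hdist : dist (γ i (t₀ - e * δ)) (γ i t₀) = δ := by
    rw [hγ.dist_same i _ ht _ ht₀]
    rcases he' with h | h <;> rw [h]
    · rw [show t₀ - 1 * δ - t₀ = -δ by ring, abs_neg, abs_of_pos hδ]
    · rw [show t₀ - -1 * δ - t₀ = δ by ring, abs_of_pos hδ]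
  refine ⟨γ i (t₀ - e * δ), fun h => ?_, ?_⟩
  · rw [h, dist_self] at hdist
    exact hδ.ne hdist
  · rw [hdist, hF _ ht, hy, hd, clamp_of_mem (by linarith) (by linarith),
      clamp_of_mem h2.le h1.le]
    ring

theorem HasRamps.isOpenArc {F : G → ℝ} {ε : ℝ} (hε : 0 < ε) (h : HasRamps F ε) {S : Set G}
    (hS : S ∈ compsOf {y | -ε < F y ∧ F y < 0}) : IsOpenArc S := by
  obtain ⟨y, hy, rfl⟩ := hS
  obtain ⟨x, v, r, γ, i, t₀, A, e, hγ, rfl, h0, hr, he, hx, hF⟩ := h y hy.1 hy.2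
  have hmem : ∀ t ∈ Ico 0 r, γ i t ∈ {y | -ε < F y ∧ F y < 0} ↔ A + e * t < ε ∧ 0 < A + e * t := by
    intro t ht
    rw [mem_ofPred_eq, hF t ht, neg_lt_neg_iff, clamp_lt_iff hε, neg_lt_zero, clamp_pos_iff hε]
  have hA := (hmem t₀ ⟨h0.le, by linarith⟩).1 hy
  have hFx := hF 0 hγ.zero_mem
  rw [hγ.zero, mul_zero, add_zero] at hFx
  have hA0 : A ≤ 0 ∨ ε ≤ A := by
    rcases hx with h | h
    · left
      rw [← not_lt, ← clamp_pos_iff hε]; linarith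
    · right
      rw [← not_lt, ← clamp_lt_iff hε]; linarith
  obtain ⟨α, hα, hα0, hαr, hmem'⟩ : ∃ α, 0 ≤ α ∧ t₀ ∈ Ioo α (α + ε) ∧ α + ε < r ∧
      ∀ t ∈ Ico 0 r, γ i t ∈ {y | -ε < F y ∧ F y < 0} ↔ t ∈ Ioo α (α + ε) := by
    rcases he with rfl | rfl
    · push_cast at hA hmem
      refine ⟨-A, ?_, ⟨?_, ?_⟩, ?_, fun t ht => (hmem t ht).trans
        ⟨fun h => ⟨?_, ?_⟩, fun h => ⟨?_, ?_⟩⟩⟩ <;>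
      first
        | (have h1 := h.1; have h2 := h.2; linarith)
        | (rcases hA0 with h | h <;> linarith)
    · push_cast at hA hmem
      refine ⟨A - ε, ?_, ⟨?_, ?_⟩, ?_, fun t ht => (hmem t ht).trans
        ⟨fun h => ⟨?_, ?_⟩, fun h => ⟨?_, ?_⟩⟩⟩ <;>
      first
        | (have h1 := h.1; have h2 := h.2; linarith)
        | (rcases hA0 with h | h <;> linarith)
  clear hmem hA hA0 hFx hF hx
  have hsub : ∀ t ∈ Ioo α (α + ε), t ∈ Ico 0 r := fun t ht =>
    ⟨hα.trans ht.1.le, ht.2.trans hαr⟩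
  have hmid : α + ε / 2 ∈ Ioo α (α + ε) := ⟨by linarith, by linarith⟩
  set c := γ i (α + ε / 2) with hc
  have hball : γ i '' Ioo α (α + ε) = Metric.ball c (ε / 2) := by
    apply Subset.antisymm
    · rintro _ ⟨t, ht, rfl⟩
      rw [Metric.mem_ball, hc, hγ.dist_same i t (hsub t ht) _ (hsub _ hmid), abs_lt]
      constructor <;> linarith [ht.1, ht.2]
    · intro z hz
      have hz := Metric.mem_ball.1 hz
      have hzx := dist_triangle z c x
      rw [hγ.dist_center i (hsub _ hmid)] at hzx
      obtain ⟨j, s, hs, rfl⟩ := hγ.surj z (by linarith)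
      by_cases hji : j = i
      · subst hji
        rw [hc, hγ.dist_same j s hs _ (hsub _ hmid), abs_lt] at hz
        exact ⟨s, ⟨by linarith [hz.1], by linarith [hz.2]⟩, rfl⟩
      · rw [hc, hγ.dist_ne j i hji s hs _ (hsub _ hmid)] at hz
        linarith [hs.1]
  have hclosed : ∀ z ∈ {y | -ε < F y ∧ F y < 0}, z ∈ Metric.closedBall c (ε / 2) →
      z ∈ Metric.ball c (ε / 2) := by
    intro z hzS hz
    have hz := Metric.mem_closedBall.1 hz
    have hzx := dist_triangle z c x
    rw [hγ.dist_center i (hsub _ hmid)] at hzx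
    obtain ⟨j, s, hs, rfl⟩ := hγ.surj z (by linarith)
    rw [← hball]
    by_cases hji : j = i
    · subst hji
      exact ⟨s, (hmem' s hs).1 hzS, rfl⟩
    · rw [hc, hγ.dist_ne j i hji s hs _ (hsub _ hmid)] at hz
      have hs0 : s = 0 := by linarith [hs.1]
      rw [hs0, hγ.zero, ← hγ.zero i] at hzS
      have := (hmem' 0 hγ.zero_mem).1 hzS
      linarith [this.1]
  refine ⟨α, α + ε, γ i, by linarith, fun s hs t ht =>
    hγ.dist_same i s (hsub s hs) t (hsub t ht), ?_⟩
  apply Subset.antisymm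
  · rw [hball]
    refine isPreconnected_connectedComponentIn.subset_left_of_subset_union
      (v := (Metric.closedBall c (ε / 2))ᶜ) Metric.isOpen_ball
      Metric.isClosed_closedBall.isOpen_compl ?_ ?_ ?_
    · exact disjoint_compl_right_iff_subset.2 Metric.ball_subset_closedBall
    · intro z hz
      by_cases hzc : z ∈ Metric.closedBall c (ε / 2)
      · exact Or.inl (hclosed z (connectedComponentIn_subset _ _ hz) hzc)
      · exact Or.inr hzc
    · exact ⟨γ i t₀, mem_connectedComponentIn hy, hball ▸ ⟨t₀, hα0, rfl⟩⟩
  · refine (isPreconnected_Ioo.image _ ((hγ.continuousOn i).mono hsub)).subset_connectedComponentIn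
      ⟨t₀, hα0, rfl⟩ ?_
    rintro _ ⟨t, ht, rfl⟩
    exact (hmem' t (hsub t ht)).2 ht

theorem isCFMove_of_hasRamps (hG : IsMetricGraph G) {F : G → ℝ} {ε : ℝ} (hε : 0 < ε)
    (hr : ∀ y, -ε ≤ F y ∧ F y ≤ 0) (hU : HasUnitSlopes F) (hR : HasRamps F ε)
    (hne : ∃ y, F y = 0) : IsCFMove F := by
  have := hG.1
  have hCF := eq_CF hr (hU.abs_sub_le hG) (hU.continuous hG) hne fun y => hR.ascent hε
  refine ⟨{y | F y = 0}, ε, hε, ⟨isClosed_eq (hU.continuous hG) continuous_const, hne,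
    hU.finite_compsOf hG 0, fun S hS => hR.isOpenArc hε ?_⟩, hCF⟩
  convert hS using 2
  ext y
  have hy := congrFun hCF y
  rw [CF] at hy
  have h1 : Metric.infDist y {y | F y = 0} < ε ↔ -ε < F y := by
    rw [hy, neg_lt_neg_iff, min_lt_iff]; simp
  simp only [mem_ofPred_eq, mem_sdiff, ZNbhd, h1]
  exact and_congr_right fun _ => ⟨fun h => h.ne, fun h => lt_of_le_of_ne (hr y).2 h⟩

theorem osc_le_of_mem_Icc {X : Type*} [Nonempty X] {F : X → ℝ} {ε : ℝ} (hr : ∀ y, -ε ≤ F y ∧ F y ≤ 0) :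
    osc F ≤ ε := by
  have h1 : sSup (range F) ≤ 0 := csSup_le (range_nonempty F) (by rintro _ ⟨y, rfl⟩; exact (hr y).2)
  have h2 : -ε ≤ sInf (range F) :=
    le_csInf (range_nonempty F) (by rintro _ ⟨y, rfl⟩; exact (hr y).1)
  rw [osc]
  linarith

/-! ### Lowering a level through a slab without critical values -/

theorem IsStarChart.ordAt_le {x : G} {v : ℕ} {r : ℝ} {γ : Fin v → ℝ → G}
    (h : IsStarChart x r γ) {f f' : G → ℝ} (hf : IsRational f) (hf' : IsRational f') {δ : ℝ}
    (hδ : 0 < δ) (hle : ∀ t, 0 < t → t < δ → t < r →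
      ∑ i, (f (γ i t) - f x) ≤ ∑ i, (f' (γ i t) - f' x)) : ordAt f x ≤ ordAt f' x := by
  obtain ⟨t, ⟨h1, h2⟩, h3⟩ := (((h.eventually_sum_eq hf).and (h.eventually_sum_eq hf')).and
    (Ioo_mem_nhdsGT (lt_min hδ h.pos))).exists
  have := hle t h3.1 (h3.2.trans_le (min_le_left _ _)) (h3.2.trans_le (min_le_right _ _))
  rw [h1, h2] at this
  exact_mod_cast le_of_mul_le_mul_right this h3.1

/-- The `j`-th chip firing move in the process of lowering `max f b` to a smaller level. -/
noncomputable def ramp (f : G → ℝ) (b ε : ℝ) (j : ℕ) (y : G) : ℝ :=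
  -clamp ε ((b - f y) / scale f y - ε * (j / scale f y : ℕ))

/-- The function obtained from `max f b` after `k` chip firing moves. -/
noncomputable def level (f : G → ℝ) (b ε : ℝ) (k : ℕ) (y : G) : ℝ :=
  max (f y) b - fired ε (scale f y) k ((b - f y) / scale f y)

theorem level_zero (f : G → ℝ) (b ε : ℝ) : level f b ε 0 = fun y => max (f y) b := by
  funext y
  simp [level, fired]

theorem level_succ (f : G → ℝ) (b ε : ℝ) (k : ℕ) :
    level f b ε (k + 1) = fun y => level f b ε k y + ramp f b ε k y := by
  funext y
  rw [level, level, ramp, fired, Finset.sum_range_succ, ← fired]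
  ring

theorem ramp_mem {f : G → ℝ} {b ε : ℝ} (hε : 0 < ε) (j : ℕ) (y : G) :
    -ε ≤ ramp f b ε j y ∧ ramp f b ε j y ≤ 0 :=
  ⟨neg_le_neg (clamp_le hε.le _), neg_nonpos.2 (clamp_nonneg _ _)⟩

theorem clamp_div_of_nonpos {ε p : ℝ} (hε : 0 < ε) (hp : p ≤ 0) (s j : ℕ) :
    clamp ε (p / s - ε * (j / s : ℕ)) = 0 := by
  refine clamp_of_nonpos ?_
  have h1 : p / s ≤ 0 := div_nonpos_of_nonpos_of_nonneg hp (Nat.cast_nonneg _)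
  have h2 : 0 ≤ ε * (j / s : ℕ) := by positivity
  linarith

theorem clamp_div_of_le {ε p : ℝ} {s j M : ℕ} (hε : 0 < ε) (hs : 0 < s) (hsM : s ∣ M)
    (hj : j < M) (hp : M * ε ≤ p) : clamp ε (p / s - ε * (j / s : ℕ)) = ε := by
  refine clamp_fired_of_le hε hs hsM hj ?_
  rwa [mul_div_cancel₀]
  exact_mod_cast hs.ne'

namespace Adapted

variable {f : G → ℝ} {C : Set ℝ} {M : ℕ} {ρ : ℝ}

theorem natAbs_eq_scale (h : Adapted f C M ρ) {y : G} (hy : f y ∉ C) {v : ℕ} {r : ℝ}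
    {γ : Fin v → ℝ → G} (hγ : IsStarChart y r γ) {i : Fin v} {σ : ℤ}
    (hl : ∀ t ∈ Ico (0:ℝ) r, f (γ i t) = f y + σ * t) : σ.natAbs = scale f y := by
  obtain ⟨r', γ', n, hγ', hn, -, hsc, hl'⟩ := h.regular hy
  rw [hsc]
  refine (hγ.natAbs_eq_of_eventually hl ?_).symm
  filter_upwards [Metric.ball_mem_nhds y hγ'.pos] with z hz
  obtain ⟨j, t, ht, rfl⟩ := hγ'.surj z hz
  rw [hγ'.dist_center j ht]
  have h0 : 0 ≤ (n:ℝ) * t := mul_nonneg (Nat.cast_nonneg _) ht.1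
  fin_cases j
  · simp [(hl' t ht).1, abs_of_nonneg ht.1]
  · simp [(hl' t ht).2.1, abs_of_nonneg ht.1]

variable {a b ε : ℝ}

theorem ramp_of_ge (hε : 0 < ε) {y : G} (hy : b ≤ f y) (j : ℕ) : ramp f b ε j y = 0 := by
  rw [ramp, clamp_div_of_nonpos hε (by linarith), neg_zero]

theorem ramp_of_le (h : Adapted f C M ρ) (hε : 0 < ε) (hM : M * ε = b - a) {y : G} (hy : f y ≤ a)
    {j : ℕ} (hj : j < M) : ramp f b ε j y = -ε := by
  rw [ramp, clamp_div_of_le hε (h.scale_pos_dvd y).1 (h.scale_pos_dvd y).2 hj (by linarith)]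

theorem ramp_branch (h : Adapted f C M ρ) (hε : 0 < ε) (hM : M * ε = b - a)
    (hC : ∀ c ∈ C, c ≤ a ∨ b ≤ c) {j : ℕ} (hj : j < M) {x : G} {v : ℕ} {r : ℝ}
    {γ : Fin v → ℝ → G} (hγ : IsStarChart x r γ) {i : Fin v} {σ : ℤ} (hσ : σ ≠ 0)
    (hσM : σ.natAbs ∣ M) (hl : ∀ t ∈ Ico (0:ℝ) r, f (γ i t) = f x + σ * t) :
    ∃ (A : ℝ) (e : ℤ), (e = 1 ∨ e = -1) ∧
      ∀ t ∈ Ico (0:ℝ) r, ramp f b ε j (γ i t) = -clamp ε (A + e * t) := by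
  obtain ⟨n, hn⟩ : ∃ n, σ.natAbs = n := ⟨_, rfl⟩
  have hn0 : 0 < n := hn ▸ Int.natAbs_pos.2 hσ
  have hn0' : (n : ℝ) ≠ 0 := by exact_mod_cast hn0.ne'
  obtain ⟨e, he, heσ⟩ : ∃ e : ℤ, (e = 1 ∨ e = -1) ∧ σ = -e * n := by
    rcases lt_or_gt_of_ne hσ with h | h
    · exact ⟨1, Or.inl rfl, by omega⟩
    · exact ⟨-1, Or.inr rfl, by omega⟩
  refine ⟨(b - f x) / n - ε * (j / n : ℕ), e, he, fun t ht => ?_⟩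
  rcases eq_or_lt_of_le ht.1 with rfl | h0
  · rw [hγ.zero, mul_zero, add_zero]
    by_cases hx : f x ∈ C
    · rcases hC _ hx with hx | hx
      · rw [h.ramp_of_le hε hM hx hj, clamp_div_of_le hε hn0 (hn ▸ hσM) hj (by linarith)]
      · rw [ramp_of_ge hε hx, clamp_div_of_nonpos hε (by linarith), neg_zero]
    · rw [ramp, ← h.natAbs_eq_scale hx hγ hl, hn]
  · rw [ramp, hγ.scale_branch hl hσ h0 ht.2, hn, hl t ht, heσ]
    congr 2
    push_cast
    field_simp
    ring

theorem ramp_of_mem (h : Adapted f C M ρ) (hε : 0 < ε) (hM : M * ε = b - a)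
    (hC : ∀ c ∈ C, c ≤ a ∨ b ≤ c) {j : ℕ} (hj : j < M) {y : G} (hy : f y ∈ C) :
    ramp f b ε j y = 0 ∨ ramp f b ε j y = -ε := by
  rcases hC _ hy with h' | h'
  · exact Or.inr (h.ramp_of_le hε hM h' hj)
  · exact Or.inl (ramp_of_ge hε h' j)

theorem hasUnitSlopes_ramp (h : Adapted f C M ρ) (hε : 0 < ε) (hM : M * ε = b - a)
    (hC : ∀ c ∈ C, c ≤ a ∨ b ≤ c) {j : ℕ} (hj : j < M) : HasUnitSlopes (ramp f b ε j) := by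
  refine hasUnitSlopes_of_clamp hε fun y => ?_
  obtain ⟨v, r, γ, σ, hγ, hl, hd⟩ := h.chart y
  refine ⟨v, r, γ, hγ, fun i => ?_⟩
  by_cases hσ : σ i = 0
  · have hfy : ∀ t ∈ Ico (0:ℝ) r, f (γ i t) = f y := fun t ht => by rw [hl i t ht, hσ]; simp
    by_cases hy : f y ∈ C
    · rcases hC _ hy with hy | hy
      · refine ⟨ε, 0, Or.inl rfl, fun t ht => ?_⟩
        rw [h.ramp_of_le hε hM ((hfy t ht).trans_le hy) hj, clamp_of_le hε.le (by simp)]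
      · refine ⟨0, 0, Or.inl rfl, fun t ht => ?_⟩
        rw [ramp_of_ge hε (hy.trans_eq (hfy t ht).symm), clamp_of_nonpos (by simp), neg_zero]
    · have h1 := h.natAbs_eq_scale hy hγ (hl i)
      have h2 := (h.scale_pos_dvd y).1
      rw [← h1, hσ] at h2
      simp at h2
  · obtain ⟨A, e, he, hr⟩ := h.ramp_branch hε hM hC hj hγ hσ (hd i hσ) (hl i)
    exact ⟨A, e, Or.inr he, hr⟩

theorem hasRamps_ramp (h : Adapted f C M ρ) (hε : 0 < ε) (hερ : ε < ρ) (hM : M * ε = b - a)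
    (hC : ∀ c ∈ C, c ≤ a ∨ b ≤ c) {j : ℕ} (hj : j < M) : HasRamps (ramp f b ε j) ε := by
  intro y h1 h2
  have hy : f y ∉ C := fun hy => by
    rcases h.ramp_of_mem hε hM hC hj hy with h' | h'
    · exact h2.ne h'
    · exact h1.ne' h'
  obtain ⟨x, v, r, γ, i, t₀, σ, hγ, hyt, h0, hr, hσ, hd, hx, hl⟩ := h.edge y hy
  obtain ⟨A, e, he, hA⟩ := h.ramp_branch hε hM hC hj hγ hσ hd hl
  exact ⟨x, v, r, γ, i, t₀, A, e, hγ, hyt, h0, by linarith, he,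
    h.ramp_of_mem hε hM hC hj hx, hA⟩

theorem isCFMove_ramp (h : Adapted f C M ρ) (hG : IsMetricGraph G) (hε : 0 < ε) (hερ : ε < ρ)
    (hM : M * ε = b - a) (hC : ∀ c ∈ C, c ≤ a ∨ b ≤ c) (hb : ∃ y, b ≤ f y) {j : ℕ} (hj : j < M) :
    IsCFMove (ramp f b ε j) :=
  isCFMove_of_hasRamps hG hε (ramp_mem hε j) (h.hasUnitSlopes_ramp hε hM hC hj)
    (h.hasRamps_ramp hε hερ hM hC hj) (hb.imp fun _ hy => ramp_of_ge hε hy j)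

theorem isRational_level (h : Adapted f C M ρ) (hG : IsMetricGraph G) (hf : IsRational f)
    (hε : 0 < ε) (hM : M * ε = b - a) (hC : ∀ c ∈ C, c ≤ a ∨ b ≤ c) {k : ℕ} (hk : k ≤ M) :
    IsRational (level f b ε k) := by
  induction k with
  | zero => rw [level_zero]; exact hf.max_const b
  | succ k ih =>
    rw [level_succ]
    exact (ih (by omega)).add ((h.hasUnitSlopes_ramp hε hM hC hk).isRational hG)

theorem level_of_ge (hε : 0 < ε) {y : G} (hy : b ≤ f y) (k : ℕ) : level f b ε k y = f y := by
  rw [level, max_eq_left hy, fired_of_nonpos hε, sub_zero]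
  exact div_nonpos_of_nonpos_of_nonneg (by linarith) (Nat.cast_nonneg _)

theorem le_level (h : Adapted f C M ρ) (hε : 0 < ε) (k : ℕ) (y : G) : f y ≤ level f b ε k y := by
  rcases le_total b (f y) with hy | hy
  · rw [level_of_ge hε hy]
  · have hs := (h.scale_pos_dvd y).1
    have hs' : (scale f y : ℝ) ≠ 0 := by exact_mod_cast hs.ne'
    have := fired_le_mul hε hs (div_nonneg (sub_nonneg.2 hy) (Nat.cast_nonneg (scale f y))) k
    rw [mul_div_cancel₀ _ hs'] at this
    rw [level, max_eq_right hy]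
    linarith

theorem level_of_le (h : Adapted f C M ρ) (hε : 0 < ε) (hM : M * ε = b - a) {y : G}
    (hy : f y ≤ a) {k : ℕ} (hk : k ≤ M) : level f b ε k y = b - k * ε := by
  have hab : 0 ≤ b - a := by rw [← hM]; positivity
  have hs := (h.scale_pos_dvd y).1
  have hs' : (scale f y : ℝ) ≠ 0 := by exact_mod_cast hs.ne'
  rw [level, max_eq_right (by linarith), fired_of_le hε hs (h.scale_pos_dvd y).2 hk]
  rw [mul_div_cancel₀ _ hs']
  linarith

theorem level_total (h : Adapted f C M ρ) (hε : 0 < ε) (hM : M * ε = b - a) :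
    level f b ε M = fun y => max (f y) a := by
  have hab : 0 ≤ b - a := by rw [← hM]; positivity
  funext y
  have hs := (h.scale_pos_dvd y).1
  have hs' : (scale f y : ℝ) ≠ 0 := by exact_mod_cast hs.ne'
  rcases le_total (f y) a with hy | hy
  · rw [h.level_of_le hε hM hy le_rfl, max_eq_right hy]
    linarith
  rw [max_eq_left hy]
  rcases le_total b (f y) with hy' | hy'
  · exact level_of_ge hε hy' M
  · rw [level, max_eq_right hy', fired_total hε hs (h.scale_pos_dvd y).2
      (div_nonneg (sub_nonneg.2 hy') (Nat.cast_nonneg _)), mul_div_cancel₀ _ hs']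
    · ring
    · rw [mul_div_cancel₀ _ hs']
      linarith

theorem ordAt_level (h : Adapted f C M ρ) (hG : IsMetricGraph G) (hf : IsRational f)
    (hε : 0 < ε) (hM : M * ε = b - a) (hC : ∀ c ∈ C, c ≤ a ∨ b ≤ c) {k : ℕ} (hk : k ≤ M)
    (y : G) : 0 ≤ ordAt (level f b ε k) y ∨ ordAt f y ≤ ordAt (level f b ε k) y := by
  have hH := h.isRational_level hG hf hε hM hC hk
  have hc := isRational_const (G := G) 0
  have hc0 := ordAt_const hG 0 y
  by_cases hy : f y ∈ C
  · obtain ⟨v, r, γ, hγ⟩ := exists_isStarChart hG y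
    rcases hC _ hy with hy | hy
    · left
      rw [← hc0]
      refine hγ.ordAt_le hc hH one_pos fun t _ _ _ => Finset.sum_le_sum fun i _ => ?_
      rw [h.level_of_le hε hM hy hk, level, sub_self]
      linarith [fired_le (s := scale f (γ i t)) hε k ((b - f (γ i t)) / scale f (γ i t)),
        le_max_right (f (γ i t)) b]
    · right
      refine hγ.ordAt_le hf hH one_pos fun t _ _ _ => Finset.sum_le_sum fun i _ => ?_
      rw [level_of_ge hε hy k]
      linarith [h.le_level (b := b) hε k (γ i t)]
  · rcases le_or_gt b (f y) with hyb | hyb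
    · right
      obtain ⟨v, r, γ, hγ⟩ := exists_isStarChart hG y
      refine hγ.ordAt_le hf hH one_pos fun t _ _ _ => Finset.sum_le_sum fun i _ => ?_
      rw [level_of_ge hε hyb k]
      linarith [h.le_level (b := b) hε k (γ i t)]
    · left
      obtain ⟨r, γ, n, hγ, hn, -, hs, hl⟩ := h.regular hy
      have hn' : (0:ℝ) < n := by exact_mod_cast hn
      rw [← hc0]
      refine hγ.ordAt_le hc hH (div_pos (sub_pos.2 hyb) hn') fun t h0 hδ hr => ?_
      obtain ⟨h1, h2, h3⟩ := hl t ⟨h0.le, hr⟩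
      have hδ' := (lt_div_iff₀ hn').1 hδ
      have hnt : 0 ≤ n * t := by positivity
      have hmid := fired_midpoint hε hn h0.le (sub_nonneg.2 hδ.le) k
      simp only [Fin.sum_univ_two, level, h3, hs, h1, h2, sub_self, add_zero]
      rw [max_eq_right (by linarith), max_eq_right hyb.le, max_eq_right (by linarith)]
      have e1 : (b - (f y + n * t)) / n = (b - f y) / n - t := by field_simp; ring
      have e2 : (b - (f y - n * t)) / n = (b - f y) / n + t := by field_simp; ring
      rw [e1, e2]
      linarith

end Adapted

/-- `H'` is obtained from `H` by a chip firing move of norm at most that of `f`, which is legal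
whenever `f` is in the linear system. -/
structure LegalStep (f H H' : G → ℝ) : Prop where
  rational : IsRational H
  move : ∃ F : G → ℝ, IsCFMove F ∧ IsRational F ∧ osc F ≤ osc f ∧ H' = fun y => H y + F y
  legal : ∀ D : G → ℤ, Effective D → f ∈ RD D → ∀ x, 0 ≤ D x + ordAt H' x

theorem Adapted.reflTransGen_slab {f : G → ℝ} {C : Set ℝ} {M : ℕ} {ρ : ℝ}
    (h : Adapted f C M ρ) (hG : IsMetricGraph G) (hf : IsRational f) {a b : ℝ} (hab : a < b)
    (hC : ∀ c ∈ C, c ≤ a ∨ b ≤ c) (hb : ∃ y, b ≤ f y) (hosc : b - a ≤ osc f) :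
    Relation.ReflTransGen (LegalStep f) (fun y => max (f y) b) (fun y => max (f y) a) := by
  have hMpos : (0:ℝ) < M := by exact_mod_cast h.M_pos
  obtain ⟨N, hN⟩ := exists_nat_gt ((b - a) / (M * ρ))
  have hN0 : 0 < N := by
    have : (0:ℝ) < N := lt_of_le_of_lt
      (div_nonneg (by linarith) (mul_nonneg hMpos.le h.ρ_pos.le)) hN
    exact_mod_cast this
  obtain ⟨K, hK⟩ : ∃ K, K = N * M := ⟨_, rfl⟩
  have hKa : Adapted f C K ρ := hK ▸ h.mul hN0
  have hKpos : (0:ℝ) < K := by exact_mod_cast hKa.M_pos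
  have hK1 : (1:ℝ) ≤ K := by exact_mod_cast hKa.M_pos
  obtain ⟨ε, hε⟩ : ∃ ε, ε = (b - a) / K := ⟨_, rfl⟩
  have hε0 : 0 < ε := hε ▸ div_pos (by linarith) hKpos
  have hKε : K * ε = b - a := by rw [hε]; field_simp
  have hερ : ε < ρ := by
    rw [div_lt_iff₀ (mul_pos hMpos h.ρ_pos)] at hN
    rw [hε, div_lt_iff₀ hKpos, hK]
    push_cast
    linarith
  have : Nonempty G := hb.nonempty
  suffices hs : ∀ k ≤ K, Relation.ReflTransGen (LegalStep f) (level f b ε 0) (level f b ε k) by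
    rw [← level_zero f b ε, ← hKa.level_total hε0 hKε]
    exact hs K le_rfl
  intro k
  induction k with
  | zero => exact fun _ => Relation.ReflTransGen.refl
  | succ k ih =>
    intro hk
    have hk' : k < K := hk
    refine (ih hk'.le).tail ⟨hKa.isRational_level hG hf hε0 hKε hC hk'.le,
      ⟨ramp f b ε k, hKa.isCFMove_ramp hG hε0 hερ hKε hC hb hk',
        (hKa.hasUnitSlopes_ramp hε0 hKε hC hk').isRational hG, ?_, level_succ f b ε k⟩,
      fun D hD hfD x => ?_⟩
    · refine (osc_le_of_mem_Icc (ramp_mem hε0 k)).trans (le_trans ?_ hosc)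
      rw [← hKε]
      exact le_mul_of_one_le_left hε0.le hK1
    · rcases hKa.ordAt_level hG hf hε0 hKε hC hk x with h | h
      · linarith [hD x]
      · linarith [hfD.2 x]

theorem Adapted.reflTransGen {f : G → ℝ} {C : Set ℝ} {M : ℕ} {ρ : ℝ} (h : Adapted f C M ρ)
    (hC : C.Finite) (hG : IsMetricGraph G) (hf : IsRational f) {a b : ℝ} (hab : a ≤ b)
    (hb : ∃ y, b ≤ f y) (hosc : b - a ≤ osc f) :
    Relation.ReflTransGen (LegalStep f) (fun y => max (f y) b) (fun y => max (f y) a) := by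
  obtain ⟨n, hn⟩ : ∃ n, (C ∩ Ioo a b).ncard = n := ⟨_, rfl⟩
  induction n using Nat.strong_induction_on generalizing a b with
  | _ n ih =>
    rcases eq_or_lt_of_le hab with rfl | hab'
    · exact Relation.ReflTransGen.refl
    by_cases hex : ∃ c ∈ C, a < c ∧ c < b
    · obtain ⟨c, hc, hac, hcb⟩ := hex
      have hlt : ∀ a' b', a ≤ a' → b' ≤ b → c ∉ Ioo a' b' → (C ∩ Ioo a' b').ncard < n := by
        intro a' b' ha' hb' hcn
        rw [← hn]
        refine ncard_lt_ncard ⟨fun z hz => ⟨hz.1, ha'.trans_lt hz.2.1, hz.2.2.trans_le hb'⟩,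
          fun hsub => hcn (hsub ⟨hc, hac, hcb⟩).2⟩ (hC.inter_of_left _)
      exact (ih _ (hlt c b hac.le le_rfl fun h => h.1.false) hcb.le hb (by linarith) rfl).trans
        (ih _ (hlt a c le_rfl hcb.le fun h => h.2.false) hac.le
          (hb.imp fun _ hy => hcb.le.trans hy) (by linarith) rfl)
    · refine h.reflTransGen_slab hG hf hab' (fun c hc => ?_) hb hosc
      by_contra! hcon
      exact hex ⟨c, hc, hcon⟩

theorem exists_seq_of_reflTransGen {α : Type*} {r : α → α → Prop} {x y : α}
    (h : Relation.ReflTransGen r x y) :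
    ∃ (n : ℕ) (s : ℕ → α), s 0 = x ∧ s n = y ∧ ∀ k < n, r (s k) (s (k + 1)) := by
  induction h using Relation.ReflTransGen.head_induction_on with
  | refl => exact ⟨0, fun _ => y, rfl, rfl, by simp⟩
  | @head a c hac _ ih =>
    obtain ⟨n, s, h0, hn, hs⟩ := ih
    refine ⟨n + 1, fun k => Nat.casesOn k a s, rfl, hn, fun k hk => ?_⟩
    cases k with
    | zero => simpa [h0] using hac
    | succ k => exact hs k (by omega)

theorem sum_filter_lt_sub (s : ℕ → ℝ) {n : ℕ} (k : Fin n) :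
    ∑ i ∈ Finset.univ.filter (· < k), (s (i + 1) - s i) = s k - s 0 := by
  rw [← Finset.sum_range_sub]
  refine Finset.sum_nbij (fun i : Fin n => (i : ℕ)) (fun i hi => ?_)
    (fun i _ j _ hij => Fin.ext hij) (fun i hi => ?_) fun _ _ => rfl
  · simpa using hi
  · have hi' : i < k := by simpa using hi
    exact ⟨⟨i, hi'.trans k.2⟩, Finset.mem_coe.2 (Finset.mem_filter.2 ⟨Finset.mem_univ _, hi'⟩), rfl⟩

/-- every rational function is, up to an additive constant, a sum of chip
firing moves `f_i` with `‖f_i‖_∞ ≤ ‖f‖_∞`; moreover if `f ∈ R(D)` for an effective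
divisor `D`, then the `f_i` form a sequence of legal chip firing moves:
`f_k ∈ R(D + div(f_1 + ⋯ + f_{k-1}))` for all `k`. -/
theorem rational_sum_of_chip_firings (hG : IsMetricGraph G) (f : G → ℝ)
    (hf : IsRational f) :
    ∃ (n : ℕ) (F : Fin n → G → ℝ) (c : ℝ),
      (∀ i, IsCFMove (F i)) ∧ (∀ i, osc (F i) ≤ osc f) ∧
      (∀ x, f x = c + ∑ i, F i x) ∧
      ∀ D : G → ℤ, FinSupp D → Effective D → f ∈ RD D →
        ∀ k : Fin n,
          F k ∈ RD (fun x =>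
            D x + ordAt (fun y => ∑ i ∈ Finset.univ.filter (· < k), F i y) x) := by
  rcases isEmpty_or_nonempty G with hE | hE
  · exact ⟨0, Fin.elim0, 0, fun i => i.elim0, fun i => i.elim0, fun x => hE.elim x,
      fun _ _ _ _ k => k.elim0⟩
  have := hG.1
  obtain ⟨C, M, ρ, hC, h⟩ := exists_adapted hG hf
  obtain ⟨p, -, hp⟩ := isCompact_univ.exists_isMaxOn univ_nonempty hf.1.continuousOn
  obtain ⟨q, -, hq⟩ := isCompact_univ.exists_isMinOn univ_nonempty hf.1.continuousOn
  have hp' : ∀ y, f y ≤ f p := fun y => hp (mem_univ y)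
  have hq' : ∀ y, f q ≤ f y := fun y => hq (mem_univ y)
  have hosc : f p - f q = osc f := by
    rw [osc, IsGreatest.csSup_eq (a := f p) ⟨mem_range_self p, by rintro _ ⟨y, rfl⟩; exact hp' y⟩,
      IsLeast.csInf_eq (a := f q) ⟨mem_range_self q, by rintro _ ⟨y, rfl⟩; exact hq' y⟩]
  obtain ⟨n, H, h0, hn, hstep⟩ := exists_seq_of_reflTransGen
    (h.reflTransGen hC hG hf (hq' p) ⟨p, le_rfl⟩ hosc.le)
  have h0' : ∀ y, H 0 y = f p := fun y => by rw [h0]; exact max_eq_right (hp' y)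
  have hn' : ∀ y, H n y = f y := fun y => by rw [hn]; exact max_eq_left (hq' y)
  have hF : ∀ k < n, IsCFMove (fun y => H (k + 1) y - H k y) ∧
      IsRational (fun y => H (k + 1) y - H k y) ∧
      osc (fun y => H (k + 1) y - H k y) ≤ osc f := fun k hk => by
    obtain ⟨F, h1, h2, h3, h4⟩ := (hstep k hk).move
    have hF : (fun y => H (k + 1) y - H k y) = F := by
      funext y
      rw [h4]
      exact add_sub_cancel_left _ _
    rw [hF]
    exact ⟨h1, h2, h3⟩
  refine ⟨n, fun k y => H (k + 1) y - H k y, f p, fun k => (hF k k.2).1,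
    fun k => (hF k k.2).2.2, fun x => ?_, fun D _ hD hfD k => ⟨(hF k k.2).2.1, fun x => ?_⟩⟩
  · rw [Fin.sum_univ_eq_sum_range (fun i => H (i + 1) x - H i x), Finset.sum_range_sub
      (fun i => H i x), h0', hn']
    ring
  · have h1 : (fun y => ∑ i ∈ Finset.univ.filter (· < k), (H (i + 1) y - H i y))
        = fun y => H k y + -f p := by
      funext y
      rw [sum_filter_lt_sub (fun i => H i y) k, h0', sub_eq_add_neg]
    have hk := hstep k k.2
    beta_reduce
    rw [h1, ordAt_add hG hk.rational (isRational_const _), ordAt_const hG, add_zero, add_assoc,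
      ← ordAt_add hG hk.rational (hF k k.2).2.1]
    simpa using hk.legal D hD hfD x

end TropGraph
end

section
/- Let D be a v-reduced divisor on a metric graph Γ. Then for every f ∈ R(D), every local maximum Z ⊆ Γ of f contains v. In particular, every f ∈ R(D) attains its maximum at v. -/
open scoped ENNReal
open Set Function

namespace TropGraph

variable {G : Type*} [MetricSpace G]

/-! ### Branches of a star-shaped neighbourhood -/

/-- The distance to the centre of a star. -/
def StarGlue.radius {n : ℕ} {ε : ℝ} : StarGlue n ε → ℝ :=
  Quotient.lift (fun p => (p.2 : ℝ)) (by
    rintro a b (rfl | ⟨ha, hb⟩)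
    · rfl
    · exact ha.trans hb.symm)

/-- An open branch of a star, without its centre. -/
def StarGlue.branch {n : ℕ} {ε : ℝ} (i : Fin n) : Set (StarGlue n ε) :=
  {q | ∃ s : Set.Ico (0 : ℝ) ε, 0 < (s : ℝ) ∧ q = Quotient.mk (starSetoid n ε) (i, s)}

theorem StarGlue.continuous_radius {n : ℕ} {ε : ℝ} :
    Continuous (StarGlue.radius : StarGlue n ε → ℝ) :=
  Continuous.quotient_lift (continuous_subtype_val.comp continuous_snd) _

theorem StarGlue.isOpen_branch {n : ℕ} {ε : ℝ} (i : Fin n) :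
    IsOpen (StarGlue.branch i : Set (StarGlue n ε)) := by
  change IsOpen ((Quotient.mk (starSetoid n ε)) ⁻¹' StarGlue.branch i)
  have h : (Quotient.mk (starSetoid n ε)) ⁻¹' StarGlue.branch i =
      {p : Fin n × Set.Ico (0 : ℝ) ε | p.1 = i ∧ 0 < (p.2 : ℝ)} := by
    ext ⟨j, s⟩
    constructor
    · rintro ⟨t, ht, h⟩
      rcases Quotient.exact h with h | ⟨-, h⟩
      · cases h
        exact ⟨rfl, ht⟩
      · exact absurd h ht.ne'
    · rintro ⟨rfl, hs⟩
      exact ⟨s, hs, rfl⟩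
  rw [h]
  exact ((isOpen_discrete {i}).preimage continuous_fst).inter
    (isOpen_lt continuous_const (continuous_subtype_val.comp continuous_snd))

/-- A punctured neighbourhood of `x` split into `n` disjoint open branches, each with an
injective continuous coordinate that tends to `0` at `x`. -/
structure BranchSystem (x : G) (n : ℕ) where
  nbhd : Set G
  radius : G → ℝ
  branch : Fin n → Set G
  isOpen_nbhd : IsOpen nbhd
  mem_nbhd : x ∈ nbhd
  continuousOn_radius : ContinuousOn radius nbhd
  radius_center : radius x = 0
  isOpen_branch : ∀ i, IsOpen (branch i)
  branch_subset : ∀ i, branch i ⊆ nbhd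
  disjoint_branch : Pairwise (Disjoint on branch)
  exists_mem_branch : ∀ y ∈ nbhd, y ≠ x → ∃ i, y ∈ branch i
  radius_pos : ∀ i, ∀ y ∈ branch i, 0 < radius y
  injOn_radius : ∀ i, Set.InjOn radius (branch i)

open scoped Classical in
theorem IsStarNbhdOf.nonempty_branchSystem {x : G} {n : ℕ} {U : Set G}
    (h : IsStarNbhdOf x n U) (hU : U ∈ nhds x) : Nonempty (BranchSystem x n) := by
  obtain ⟨ε, hε, φ, hx, hφ⟩ := h
  let r : G → ℝ := fun y => if h : y ∈ U then (φ ⟨y, h⟩).radius else 0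
  have hr : ∀ y (h : y ∈ U), r y = (φ ⟨y, h⟩).radius := fun y h => dif_pos h
  have hn : Nonempty (Fin n) := by
    obtain ⟨⟨i, -⟩, -⟩ := Quotient.exists_rep (φ ⟨x, hx⟩)
    exact ⟨i⟩
  refine ⟨{
    nbhd := interior U
    radius := r
    branch := fun i => interior U ∩ Subtype.val '' (φ ⁻¹' StarGlue.branch i)
    isOpen_nbhd := isOpen_interior
    mem_nbhd := mem_interior_iff_mem_nhds.2 hU
    continuousOn_radius := ?_
    radius_center := ?_
    isOpen_branch := ?_
    branch_subset := fun i => Set.inter_subset_left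
    disjoint_branch := ?_
    exists_mem_branch := ?_
    radius_pos := ?_
    injOn_radius := ?_ }⟩
  · refine ContinuousOn.mono ?_ interior_subset
    rw [continuousOn_iff_continuous_domRestrict]
    refine (StarGlue.continuous_radius.comp φ.continuous).congr fun y => ?_
    exact (hr y y.2).symm
  · rw [hr x hx, hφ hn.some]
    rfl
  · intro i
    obtain ⟨V, hV, hVi⟩ :=
      isOpen_induced_iff.1 ((StarGlue.isOpen_branch i).preimage φ.continuous)
    rw [← hVi, Subtype.image_preimage_coe, ← Set.inter_assoc,
      Set.inter_eq_left.2 interior_subset]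
    exact isOpen_interior.inter hV
  · intro i j hij
    refine Set.disjoint_left.2 ?_
    rintro _ ⟨-, ⟨y, ⟨s, hs, hys⟩, rfl⟩⟩ ⟨-, ⟨z, ⟨t, ht, hzt⟩, hzy⟩⟩
    obtain rfl := Subtype.val_injective hzy
    rcases Quotient.exact (hys.symm.trans hzt) with h | ⟨h, -⟩
    · exact hij (congrArg Prod.fst h)
    · exact hs.ne' h
  · intro y hy hyx
    have hyU := interior_subset hy
    obtain ⟨⟨i, s⟩, his⟩ := Quotient.exists_rep (φ ⟨y, hyU⟩)
    refine ⟨i, hy, ⟨y, hyU⟩, ⟨s, ?_, his.symm⟩, rfl⟩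
    refine lt_of_le_of_ne s.2.1 fun h0 => hyx ?_
    have : φ ⟨y, hyU⟩ = φ ⟨x, hx⟩ := by
      rw [hφ i, ← his]
      exact Quotient.sound (Or.inr ⟨h0.symm, rfl⟩)
    exact congrArg Subtype.val (φ.injective this)
  · rintro i _ ⟨-, ⟨y, ⟨s, hs, hys⟩, rfl⟩⟩
    rw [hr y y.2, Subtype.coe_eta, hys]
    exact hs
  · rintro i _ ⟨-, ⟨y, ⟨s, hs, hys⟩, rfl⟩⟩ _ ⟨-, ⟨z, ⟨t, ht, hzt⟩, rfl⟩⟩ hyz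
    rw [hr y y.2, hr z z.2, Subtype.coe_eta, Subtype.coe_eta, hys, hzt] at hyz
    have hst : s = t := Subtype.ext hyz
    rw [φ.injective (hys.trans (hst ▸ hzt.symm))]

/-! ### Unit speed paths inside a branch -/

theorem IsUnitSpeedFrom.dist_start {x : G} {ε t : ℝ} {g : ℝ → G} (hg : IsUnitSpeedFrom x ε g)
    (ht : t ∈ Set.Ico 0 ε) : dist x (g t) = t := by
  have h := hg.2 0 ⟨le_rfl, ht.1.trans_lt ht.2⟩ t ht
  rwa [hg.1, zero_sub, abs_neg, abs_of_nonneg ht.1] at h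

theorem IsUnitSpeedFrom.injOn {x : G} {ε : ℝ} {g : ℝ → G} (hg : IsUnitSpeedFrom x ε g) :
    Set.InjOn g (Set.Ico 0 ε) := by
  intro s hs t ht hst
  rw [← hg.dist_start hs, hst, hg.dist_start ht]

theorem IsUnitSpeedFrom.continuousOn {x : G} {ε : ℝ} {g : ℝ → G}
    (hg : IsUnitSpeedFrom x ε g) : ContinuousOn g (Set.Ico 0 ε) := by
  refine LipschitzOnWith.continuousOn (K := 1) (LipschitzOnWith.of_dist_le_mul ?_)
  intro s hs t ht
  rw [hg.2 s hs t ht, Real.dist_eq]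
  simp

/-- A unit speed path starts inside a single branch. -/
theorem IsUnitSpeedFrom.exists_branch {x : G} {n : ℕ} (b : BranchSystem x n) {ε : ℝ}
    (hε : 0 < ε) {g : ℝ → G} (hg : IsUnitSpeedFrom x ε g) :
    ∃ i, ∃ δ > 0, δ ≤ ε ∧ Set.MapsTo g (Set.Ioo 0 δ) (b.branch i) := by
  obtain ⟨ρ, hρ, hball⟩ := Metric.isOpen_iff.1 b.isOpen_nbhd x b.mem_nbhd
  have hδ : 0 < min ε ρ := lt_min hε hρ
  have hsub : Set.Ioo 0 (min ε ρ) ⊆ Set.Ico 0 ε := fun t ht =>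
    ⟨ht.1.le, ht.2.trans_le (min_le_left _ _)⟩
  have hcover : ∀ t ∈ Set.Ioo 0 (min ε ρ), ∃ i, g t ∈ b.branch i := by
    intro t ht
    have hd := hg.dist_start (hsub ht)
    refine b.exists_mem_branch _ (hball ?_) ?_
    · rw [Metric.mem_ball, dist_comm, hd]
      exact ht.2.trans_le (min_le_right _ _)
    · intro h
      rw [h, dist_self] at hd
      exact ht.1.ne hd
  have hmid : min ε ρ / 2 ∈ Set.Ioo 0 (min ε ρ) := ⟨half_pos hδ, half_lt_self hδ⟩
  obtain ⟨i, hi⟩ := hcover _ hmid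
  refine ⟨i, _, hδ, min_le_left _ _, Set.mapsTo_iff_image_subset.2 ?_⟩
  have hconn : IsPreconnected (g '' Set.Ioo 0 (min ε ρ)) :=
    isPreconnected_Ioo.image g (hg.continuousOn.mono hsub)
  refine hconn.subset_left_of_subset_union (b.isOpen_branch i)
    (isOpen_iUnion fun j => isOpen_iUnion fun (_ : i ≠ j) => b.isOpen_branch j) ?_ ?_
    ⟨_, ⟨_, hmid, rfl⟩, hi⟩
  · simp only [Set.disjoint_iUnion_right]
    exact fun j hij => b.disjoint_branch hij
  · rintro _ ⟨t, ht, rfl⟩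
    obtain ⟨j, hj⟩ := hcover t ht
    rcases eq_or_ne i j with rfl | hij
    · exact Or.inl hj
    · exact Or.inr (Set.mem_iUnion₂.2 ⟨j, hij, hj⟩)

theorem BranchSystem.continuousOn_radius_comp {x : G} {n : ℕ} (b : BranchSystem x n)
    {ε δ : ℝ} {g : ℝ → G} (hg : IsUnitSpeedFrom x ε g) (hδ : δ ≤ ε) {i : Fin n}
    (hi : Set.MapsTo g (Set.Ioo 0 δ) (b.branch i)) :
    ContinuousOn (b.radius ∘ g) (Set.Ico 0 δ) := by
  refine b.continuousOn_radius.comp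
    (hg.continuousOn.mono (Set.Ico_subset_Ico_right hδ)) fun t ht => ?_
  rcases ht.1.eq_or_lt with rfl | h
  · rw [hg.1]
    exact b.mem_nbhd
  · exact b.branch_subset i (hi ⟨h, ht.2⟩)

/-- A set that contains an initial piece of a unit speed path from `x`, apart from `x`, has a
smaller initial piece in its interior. -/
theorem IsUnitSpeedFrom.exists_mem_interior {x : G} {n : ℕ} (b : BranchSystem x n) {ε : ℝ}
    (hε : 0 < ε) {g : ℝ → G} (hg : IsUnitSpeedFrom x ε g) {Z : Set G} {η : ℝ} (hη : 0 < η)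
    (hZ : ∀ t ∈ Set.Ioo 0 η, g t ∈ Z) :
    ∃ δ > 0, ∀ t ∈ Set.Ioo 0 δ, g t ∈ interior Z := by
  obtain ⟨i, δ, hδ, hδε, hi⟩ := hg.exists_branch b hε
  have hc := b.continuousOn_radius_comp hg hδε hi
  have hsub : Set.Ioo 0 δ ⊆ Set.Ico 0 ε := fun t ht => ⟨ht.1.le, ht.2.trans_le hδε⟩
  have hinj : Set.InjOn (b.radius ∘ g) (Set.Ioo 0 δ) :=
    (b.injOn_radius i).comp (hg.injOn.mono hsub) hi
  refine ⟨min δ η, lt_min hδ hη, fun t ht => ?_⟩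
  obtain ⟨c, hc0, hct⟩ := exists_between ht.1
  obtain ⟨d, htd, hd⟩ := exists_between ht.2
  have hcd : Set.Icc c d ⊆ Set.Ioo 0 δ := fun s hs =>
    ⟨hc0.trans_le hs.1, hs.2.trans_lt (hd.trans_le (min_le_left _ _))⟩
  have hcont : ContinuousOn (b.radius ∘ g) (Set.Icc c d) :=
    hc.mono (hcd.trans Set.Ioo_subset_Ico_self)
  have hle : c ≤ d := (hct.trans htd).le
  have htm : t ∈ Set.Icc c d := ⟨hct.le, htd.le⟩
  have hmono := hcont.strictMonoOn_of_injOn_Icc' hle (hinj.mono hcd)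
  set u := (b.radius ∘ g) c with hu
  set w := (b.radius ∘ g) d with hw
  have hbetween : b.radius (g t) ∈ Set.Ioo (min u w) (max u w) := by
    rcases hmono with h | h
    · exact ⟨(min_le_left _ _).trans_lt (h ⟨le_rfl, hle⟩ htm hct),
        (h htm ⟨hle, le_rfl⟩ htd).trans_le (le_max_right _ _)⟩
    · exact ⟨(min_le_right _ _).trans_lt (h htm ⟨hle, le_rfl⟩ htd),
        (h ⟨le_rfl, hle⟩ htm hct).trans_le (le_max_left _ _)⟩
  refine mem_interior.2 ⟨b.branch i ∩ b.radius ⁻¹' Set.Ioo (min u w) (max u w), ?_,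
    (b.continuousOn_radius.mono (b.branch_subset i)).isOpen_inter_preimage
      (b.isOpen_branch i) isOpen_Ioo, hi (hcd htm), hbetween⟩
  rintro y ⟨hy, hyr⟩
  obtain ⟨s, hs, hsy⟩ : ∃ s ∈ Set.Icc c d, (b.radius ∘ g) s = b.radius y := by
    have h := intermediate_value_uIcc (hcont.mono (Set.uIcc_of_le hle).subset)
    obtain ⟨s, hs, hsy⟩ := h (Set.Ioo_subset_Icc_self hyr)
    exact ⟨s, (Set.uIcc_of_le hle).subset hs, hsy⟩
  rw [← b.injOn_radius i (hi (hcd hs)) hy hsy]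
  exact hZ s ⟨hc0.trans_le hs.1, hs.2.trans_lt (hd.trans_le (min_le_right _ _))⟩

/-- Two unit speed paths that start in the same branch agree near their starting point. -/
theorem IsUnitSpeedFrom.eventually_eq {x : G} {n : ℕ} (b : BranchSystem x n) {i : Fin n}
    {ε₁ δ₁ : ℝ} {g₁ : ℝ → G} (hg₁ : IsUnitSpeedFrom x ε₁ g₁) (hδ₁ : 0 < δ₁) (hle₁ : δ₁ ≤ ε₁)
    (hi₁ : Set.MapsTo g₁ (Set.Ioo 0 δ₁) (b.branch i))
    {ε₂ δ₂ : ℝ} {g₂ : ℝ → G} (hg₂ : IsUnitSpeedFrom x ε₂ g₂) (hδ₂ : 0 < δ₂) (hle₂ : δ₂ ≤ ε₂)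
    (hi₂ : Set.MapsTo g₂ (Set.Ioo 0 δ₂) (b.branch i)) :
    ∃ δ > 0, ∀ t ∈ Set.Ico 0 δ, g₁ t = g₂ t := by
  have hc₁ := b.continuousOn_radius_comp hg₁ hle₁ hi₁
  have hc₂ := b.continuousOn_radius_comp hg₂ hle₂ hi₂
  have hmid : δ₂ / 2 ∈ Set.Ioo 0 δ₂ := ⟨half_pos hδ₂, half_lt_self hδ₂⟩
  have hpos := b.radius_pos i _ (hi₂ hmid)
  obtain ⟨δ, hδ, hsmall⟩ := Metric.continuousOn_iff.1 hc₁ 0 ⟨le_rfl, hδ₁⟩ _ hpos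
  refine ⟨min δ δ₁, lt_min hδ hδ₁, fun t ht => ?_⟩
  rcases ht.1.eq_or_lt with rfl | ht0
  · rw [hg₁.1, hg₂.1]
  have ht₁ : t ∈ Set.Ioo 0 δ₁ := ⟨ht0, ht.2.trans_le (min_le_right _ _)⟩
  have hlt : b.radius (g₁ t) < b.radius (g₂ (δ₂ / 2)) := by
    have h := hsmall t ⟨ht.1, ht₁.2⟩ (by
      rw [Real.dist_eq, sub_zero, abs_of_nonneg ht.1]
      exact ht.2.trans_le (min_le_left _ _))
    rw [Function.comp_apply, Function.comp_apply, hg₁.1, b.radius_center, Real.dist_eq,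
      sub_zero] at h
    exact (le_abs_self _).trans_lt h
  have hivt := intermediate_value_Ioo hmid.1.le
    (hc₂.mono fun s hs => ⟨hs.1, hs.2.trans_lt hmid.2⟩)
  obtain ⟨s, hs, hst⟩ := hivt (a := b.radius (g₁ t))
    ⟨by rw [Function.comp_apply, hg₂.1, b.radius_center]; exact b.radius_pos i _ (hi₁ ht₁), hlt⟩
  have hs₂ : s ∈ Set.Ioo 0 δ₂ := ⟨hs.1, hs.2.trans hmid.2⟩
  have heq : g₂ s = g₁ t := b.injOn_radius i (hi₂ hs₂) (hi₁ ht₁) hst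
  have hstt : s = t := by
    rw [← hg₂.dist_start ⟨hs.1.le, hs₂.2.trans_le hle₂⟩, heq,
      hg₁.dist_start ⟨ht.1, ht₁.2.trans_le hle₁⟩]
  rw [← heq, hstt]

theorem BranchSystem.finite_tangentDir {x : G} {n : ℕ} (b : BranchSystem x n) :
    Finite (TangentDir x) := by
  have h : ∀ ζ : TangentDir x, ∃ (i : Fin n) (ε δ : ℝ), IsUnitSpeedFrom x ε (Quotient.out ζ).1 ∧
      0 < δ ∧ δ ≤ ε ∧ Set.MapsTo (Quotient.out ζ).1 (Set.Ioo 0 δ) (b.branch i) := by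
    intro ζ
    obtain ⟨ε, hε, hg⟩ := (Quotient.out ζ).2
    obtain ⟨i, δ, hδ, hδε, hi⟩ := hg.exists_branch b hε
    exact ⟨i, ε, δ, hg, hδ, hδε, hi⟩
  choose i ε δ hg hδ hδε hi using h
  refine Finite.of_injective i fun ζ ξ hζξ => ?_
  rw [← Quotient.out_eq ζ, ← Quotient.out_eq ξ]
  exact Quotient.sound ((hg ζ).eventually_eq b (hδ ζ) (hδε ζ) (hi ζ)
    (hg ξ) (hδ ξ) (hδε ξ) (hζξ ▸ hi ξ))

/-! ### Firing a set on which a rational function is locally maximal -/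

theorem IsRational.hasSlopeAlong_tangentSlope {f : G → ℝ} (hf : IsRational f) {x : G}
    (ζ : TangentDir x) : HasSlopeAlong f (Quotient.out ζ).1 (tangentSlope f ζ) := by
  obtain ⟨ε, hε, hg⟩ := (Quotient.out ζ).2
  have h := hf.2 x ε _ hε hg
  rw [tangentSlope, dif_pos h]
  exact h.choose_spec

/-- If `f` is maximal at `x` among the nearby points, and the nearby points with the same value
that lie on unit speed paths from `x` belong to `Z`, then `degOut Z x ≤ -ordAt f x`. -/
theorem IsRational.degOut_le_neg_ordAt {f : G → ℝ} (hf : IsRational f) {x : G} {n : ℕ}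
    (b : BranchSystem x n) {Z : Set G} (hmax : ∀ᶠ y in nhds x, f y ≤ f x)
    (hZ : ∀ (g : ℝ → G) (ε : ℝ), 0 < ε → IsUnitSpeedFrom x ε g →
      (∀ t ∈ Set.Ico 0 ε, f (g t) = f x) → ∃ η > 0, ∀ t ∈ Set.Ioo 0 η, g t ∈ Z) :
    (degOut Z x : ℤ) ≤ -ordAt f x := by
  classical
  have := b.finite_tangentDir
  have := Fintype.ofFinite (TangentDir x)
  let P : TangentDir x → Prop := fun ζ =>
    ∃ δ > (0 : ℝ), ∀ t ∈ Set.Ioo (0 : ℝ) δ, (Quotient.out ζ).1 t ∉ interior Z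
  have key : ∀ ζ : TangentDir x, (if P ζ then 1 else 0) ≤ -tangentSlope f ζ := by
    intro ζ
    obtain ⟨ε, hε, hg⟩ := (Quotient.out ζ).2
    obtain ⟨δ, hδ, hslope⟩ := hf.hasSlopeAlong_tangentSlope ζ
    rw [hg.1] at hslope
    have hnonpos : tangentSlope f ζ ≤ 0 := by
      obtain ⟨ρ, hρ, hball⟩ := Metric.eventually_nhds_iff.1 hmax
      obtain ⟨t, ht0, ht⟩ := exists_between (lt_min hε (lt_min hδ hρ))
      have hd := hg.dist_start ⟨ht0.le, ht.trans_le (min_le_left _ _)⟩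
      have hle := hball (y := (Quotient.out ζ).1 t) (by
        rw [dist_comm, hd]
        exact ht.trans_le ((min_le_right _ _).trans (min_le_right _ _)))
      rw [hslope t ⟨ht0.le, ht.trans_le ((min_le_right _ _).trans (min_le_left _ _))⟩] at hle
      have hs : (tangentSlope f ζ : ℝ) ≤ 0 := by
        by_contra! h
        nlinarith [mul_pos h ht0]
      exact_mod_cast hs
    split_ifs with hP
    · have hne : tangentSlope f ζ ≠ 0 := by
        intro h0
        have hmin : 0 < min ε δ := lt_min hε hδ
        obtain ⟨η, hη, hηZ⟩ := hZ _ (min ε δ) hmin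
          ⟨hg.1, fun s hs t ht => hg.2 s ⟨hs.1, hs.2.trans_le (min_le_left _ _)⟩
            t ⟨ht.1, ht.2.trans_le (min_le_left _ _)⟩⟩
          fun t ht => by
            rw [hslope t ⟨ht.1, ht.2.trans_le (min_le_right _ _)⟩, h0]
            simp
        obtain ⟨δ', hδ', hint⟩ := hg.exists_mem_interior b hε hη hηZ
        obtain ⟨δ'', hδ'', hnot⟩ := hP
        obtain ⟨t, ht0, ht⟩ := exists_between (lt_min hδ' hδ'')
        exact hnot t ⟨ht0, ht.trans_le (min_le_right _ _)⟩
          (hint t ⟨ht0, ht.trans_le (min_le_left _ _)⟩)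
      omega
    · omega
  have hcard : (degOut Z x : ℤ) = ∑ ζ : TangentDir x, if P ζ then 1 else 0 := by
    rw [Finset.sum_boole, degOut, Nat.card_eq_fintype_card, Fintype.card_subtype]
  rw [hcard, ordAt, finsum_eq_sum_of_fintype, ← Finset.sum_neg_distrib]
  exact Finset.sum_le_sum fun ζ _ => key ζ

theorem isClosed_connectedComponentIn {F : Set G} (hF : IsClosed F) (x : G) :
    IsClosed (connectedComponentIn F x) := by
  by_cases h : x ∈ F
  · rw [connectedComponentIn_eq_image h]
    exact hF.isClosedMap_subtype_val _ isClosed_connectedComponent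
  · rw [connectedComponentIn_eq_empty h]
    exact isClosed_empty

theorem compsOf_finite_of_isPreconnected {C : Set G} (hC : IsPreconnected C) :
    (compsOf C).Finite := by
  refine (Set.finite_singleton C).subset ?_
  rintro _ ⟨x, hx, rfl⟩
  exact hC.connectedComponentIn hx

/-- A closed connected set along which `f ∈ R(D)` is locally maximal, and which contains the
initial pieces of all unit speed paths starting in it on which `f` is constant, contains `v`
when `D` is `v`-reduced. -/
theorem IsReduced.mem_of_locally_maximal (hG : IsMetricGraph G) {v : G} {D : G → ℤ}
    (hred : IsReduced v D) {f : G → ℝ} (hf : f ∈ RD D) {C : Set G} (hclosed : IsClosed C)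
    (hconn : IsConnected C) (hmax : ∀ x ∈ C, ∀ᶠ y in nhds x, f y ≤ f x)
    (hpath : ∀ x ∈ C, ∀ (g : ℝ → G) (ε : ℝ), 0 < ε → IsUnitSpeedFrom x ε g →
      (∀ t ∈ Set.Ico 0 ε, f (g t) = f x) → ∃ η > 0, ∀ t ∈ Set.Ioo 0 η, g t ∈ C) :
    v ∈ C := by
  by_contra hv
  refine hred.2 C hv ⟨hconn.nonempty, hclosed,
    compsOf_finite_of_isPreconnected hconn.isPreconnected, fun x hx => ?_⟩
  have hxC := hclosed.frontier_subset hx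
  obtain ⟨n, U, hU, hstar⟩ := hG.2.2 x
  obtain ⟨b⟩ := hstar.nonempty_branchSystem hU
  have hdeg := hf.1.degOut_le_neg_ordAt b (hmax x hxC) (hpath x hxC)
  have hnonneg := hf.2 x
  omega

/-- if `D` is `v`-reduced then every local maximum of every `f ∈ R(D)`
contains `v`; in particular every `f ∈ R(D)` attains its maximum at `v`. -/
theorem reduced_local_max (hG : IsMetricGraph G) (v : G) (D : G → ℤ)
    (hD : FinSupp D) (hred : IsReduced v D) :
    ∀ f ∈ RD D, (∀ C : Set G, IsLocalMaxSet f C → v ∈ C) ∧ ∀ x, f x ≤ f v := by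
  intro f hf
  constructor
  · rintro C ⟨hclosed, hconn, hconst, U, hU, hCU, hlt⟩
    refine hred.mem_of_locally_maximal hG hf hclosed hconn (fun x hx => ?_) ?_
    · filter_upwards [hU.mem_nhds (hCU hx)] with y hy
      by_cases hyC : y ∈ C
      · exact (hconst y hyC x hx).le
      · exact (hlt y ⟨hy, hyC⟩ x hx).le
    · intro x hx g ε hε hg hfg
      obtain ⟨ρ, hρ, hball⟩ := Metric.isOpen_iff.1 hU x (hCU hx)
      refine ⟨min ε ρ, lt_min hε hρ, fun t ht => ?_⟩
      have htε : t ∈ Set.Ico 0 ε := ⟨ht.1.le, ht.2.trans_le (min_le_left _ _)⟩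
      by_contra hgt
      refine (hlt (g t) ⟨hball ?_, hgt⟩ x hx).ne (hfg t htε)
      rw [Metric.mem_ball, dist_comm, hg.dist_start htε]
      exact ht.2.trans_le (min_le_right _ _)
  · have := hG.1
    obtain ⟨p, -, hp⟩ := isCompact_univ.exists_isMaxOn ⟨v, mem_univ v⟩ hf.1.1.continuousOn
    have hp' : ∀ y, f y ≤ f p := fun y => hp (mem_univ y)
    have hclosed : IsClosed {y | f y = f p} := isClosed_eq hf.1.1 continuous_const
    have hsub : connectedComponentIn {y | f y = f p} p ⊆ {y | f y = f p} :=
      connectedComponentIn_subset _ _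
    have hv : v ∈ connectedComponentIn {y | f y = f p} p := by
      refine hred.mem_of_locally_maximal hG hf (isClosed_connectedComponentIn hclosed p)
        (isConnected_connectedComponentIn_iff.2 rfl) (fun x hx => ?_) ?_
      · exact Filter.Eventually.of_forall fun y => (hp' y).trans_eq (hsub hx).symm
      · intro x hx g ε hε hg hfg
        refine ⟨ε, hε, fun t ht => ?_⟩
        rw [connectedComponentIn_eq hx]
        refine (isPreconnected_Ico.image g hg.continuousOn).subset_connectedComponentIn
          ⟨0, ⟨le_rfl, hε⟩, hg.1⟩ ?_ ⟨t, ⟨ht.1.le, ht.2⟩, rfl⟩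
        rintro _ ⟨s, hs, rfl⟩
        exact (hfg s hs).trans (hsub hx)
    exact fun x => (hp' x).trans_eq (hsub hv).symm

end TropGraph
end
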